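/- arXiv:1501.02497 — 3 statements merged into one kernel-verified Lean document; each statement's English description precedes it below -/
import Mathlib

section
/- Sharp inverse bound for over-fitted Gaussian mixtures with bounded-away mixing weights (Theorem 4.3(b)): Let f(x|θ,Σ) be the d-variate Gaussian density. Let Θ be a bounded subset of ℝ^d and Ω ⊂ S_d^{++} a set whose elements have largest eigenvalue bounded above by a common constant. Fix k₀ ≥ 1, G₀ ∈ E_{k₀}(Θ×Ω), an integer k ≥ k₀+1, and let r̄ = r̄(k−k₀+1) be the smallest r ≥ 1 for which the system S_{k−k₀+1,r} has no nontrivial real solution. For c₀ > 0 let O_{k,c₀}(Θ×Ω) be the set of G ∈ O_k(Θ×Ω) all of whose atoms carry weight at least c₀. Then for every c₀ > 0 there exist ε₀ > 0 and C > 0 such that V(p_G, p_{G₀}) ≥ C · W_{r̄}(G, G₀)^{r̄} (and a fortiori ≥ C · W₁(G, G₀)^{r̄}) for every G ∈ O_{k,c₀}(Θ×Ω) with W_{r̄}(G, G₀) ≤ ε₀. -/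
open MeasureTheory Matrix

noncomputable section

attribute [local instance] Matrix.normedAddCommGroup Matrix.normedSpace

abbrev Vec (d : ℕ) := Fin d → ℝ
abbrev Mat (d : ℕ) := Matrix (Fin d) (Fin d) ℝ

/-- Euclidean norm on `Fin d → ℝ`. -/
def vnorm {d : ℕ} (v : Vec d) : ℝ := Real.sqrt (∑ i, v i ^ 2)

/-- Frobenius (entrywise ℓ²) norm on matrices. -/
def mnorm {d : ℕ} (A : Mat d) : ℝ := Real.sqrt (∑ i, ∑ j, A i j ^ 2)

/-- The ground distance ‖θ−θ'‖ + ‖Σ−Σ'‖ on the parameter space. -/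
def parDist {d₁ d₂ : ℕ} (p q : Vec d₁ × Mat d₂) : ℝ :=
  vnorm (p.1 - q.1) + mnorm (p.2 - q.2)

/-- A discrete mixing measure with exactly `k` distinct atoms in `P`,
with strictly positive weights summing to one. -/
structure Mix (P : Type*) (k : ℕ) where
  w : Fin k → ℝ
  atom : Fin k → P
  w_pos : ∀ i, 0 < w i
  w_sum : ∑ i, w i = 1
  atom_inj : Function.Injective atom

/-- The mixture density `p_G(x) = ∑ i p_i f(x|θ_i,Σ_i)`. -/
def Mix.density {P X : Type*} {k : ℕ} (f : P → X → ℝ) (G : Mix P k) (x : X) : ℝ :=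
  ∑ i, G.w i * f (G.atom i) x

/-- The `r`-th power Wasserstein transport cost between two mixing measures,
with ground distance `ρ`. -/
def WrPow {P : Type*} (ρ : P → P → ℝ) (r : ℝ) {k k' : ℕ}
    (G : Mix P k) (G' : Mix P k') : ℝ :=
  sInf { c : ℝ | ∃ q : Fin k → Fin k' → ℝ,
    (∀ i j, 0 ≤ q i j) ∧ (∀ i, ∑ j, q i j = G.w i) ∧ (∀ j, ∑ i, q i j = G'.w j) ∧
    c = ∑ i, ∑ j, q i j * ρ (G.atom i) (G'.atom j) ^ r }

/-- The `r`-th order Wasserstein distance between mixing measures. -/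
def Wr {P : Type*} (ρ : P → P → ℝ) (r : ℝ) {k k' : ℕ}
    (G : Mix P k) (G' : Mix P k') : ℝ :=
  WrPow ρ r G G' ^ (1 / r)

/-- The total variation distance between two densities on `X`. -/
def TV {d : ℕ} (X : Set (Vec d)) (p q : Vec d → ℝ) : ℝ :=
  (1 / 2) * ∫ x in X, |p x - q x|

/-- Directional derivative in the location parameter:  `βᵀ ∂f/∂θ (x|θ,Σ)`. -/
def dTheta {d d₁ d₂ : ℕ} (f : Vec d₁ × Mat d₂ → Vec d → ℝ)
    (p : Vec d₁ × Mat d₂) (β : Vec d₁) (x : Vec d) : ℝ :=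
  deriv (fun t : ℝ => f (p.1 + t • β, p.2) x) 0

/-- Directional derivative in the matrix parameter:  `tr((∂f/∂Σ (x|θ,Σ))ᵀ γ)`. -/
def dSigma {d d₁ d₂ : ℕ} (f : Vec d₁ × Mat d₂ → Vec d → ℝ)
    (p : Vec d₁ × Mat d₂) (γ : Mat d₂) (x : Vec d) : ℝ :=
  deriv (fun t : ℝ => f (p.1, p.2 + t • γ) x) 0


/-- The Hellinger distance between two densities on `X`. -/
def Hellinger {d : ℕ} (X : Set (Vec d)) (p q : Vec d → ℝ) : ℝ :=
  Real.sqrt ((1 / 2) * ∫ x in X, (Real.sqrt (p x) - Real.sqrt (q x)) ^ 2)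

/-- The `d`-variate Gaussian density with mean `θ` and covariance `M`. -/
def gaussDensity (d : ℕ) (θ : Vec d) (M : Mat d) (x : Vec d) : ℝ :=
  ((2 * Real.pi) ^ ((d : ℝ) / 2) * Real.sqrt M.det)⁻¹ *
    Real.exp (-((x - θ) ⬝ᵥ (M⁻¹ *ᵥ (x - θ))) / 2)

/-- The Gaussian location–covariance family. -/
def gaussFam (d : ℕ) : Vec d × Mat d → Vec d → ℝ :=
  fun p x => gaussDensity d p.1 p.2 x

/-- The system `S_{m,r}` of `r` polynomial equations in the unknowns
`(c_j, a_j, b_j)_{j=1}^m`. -/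
def SsysEq (m r : ℕ) (c a b : Fin m → ℝ) : Prop :=
  ∀ α : ℕ, 1 ≤ α → α ≤ r →
    ∑ j : Fin m, ∑ n ∈ Finset.filter (fun n : ℕ × ℕ => n.1 + 2 * n.2 = α)
        (Finset.range (α + 1) ×ˢ Finset.range (α + 1)),
      c j ^ 2 * a j ^ n.1 * b j ^ n.2 / (n.1.factorial * n.2.factorial : ℝ) = 0

/-- The system `S_{m,r}` admits a nontrivial real solution: all `c_j ≠ 0`
and at least one `a_j ≠ 0`. -/
def NontrivSol (m r : ℕ) : Prop :=
  ∃ c a b : Fin m → ℝ, SsysEq m r c a b ∧ (∀ j, c j ≠ 0) ∧ (∃ j, a j ≠ 0)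

open scoped MatrixOrder in
/-- A positive definite matrix factors as `A * Aᵀ` with `A` invertible. -/
lemma Matrix.PosDef.exists_mul_transpose {d : ℕ} {M : Mat d} (hM : M.PosDef) :
    ∃ A : Mat d, M = A * Aᵀ ∧ A.det ≠ 0 := by
  obtain ⟨B, hB⟩ := CStarAlgebra.nonneg_iff_eq_star_mul_self.mp hM.posSemidef.nonneg
  have hB' : M = Bᵀ * B := by
    rw [hB, star_eq_conjTranspose, conjTranspose_eq_transpose_of_trivial]
  refine ⟨Bᵀ, by simpa using hB', fun h => ?_⟩
  have := hM.det_pos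
  rw [hB', det_mul, h] at this
  simp at this

lemma measurableEmbedding_toLin' {d : ℕ} {A : Mat d} (hA : A.det ≠ 0) :
    MeasurableEmbedding (toLin' A : Vec d → Vec d) := by
  let e : Vec d ≃ₗ[ℝ] Vec d := LinearEquiv.ofIsUnitDet (f := toLin' A)
    (v := Pi.basisFun ℝ (Fin d)) (v' := Pi.basisFun ℝ (Fin d))
    (by
      rw [LinearMap.toMatrix_eq_toMatrix', LinearMap.toMatrix'_toLin']
      exact isUnit_iff_ne_zero.2 hA)
  exact e.toContinuousLinearEquiv.toHomeomorph.measurableEmbedding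

/-- Linear change of variables for the volume of `Fin d → ℝ`. -/
lemma integral_comp_mulVec {d : ℕ} {A : Mat d} (hA : A.det ≠ 0) (g : Vec d → ℂ) :
    ∫ y, g (A *ᵥ y) = |A.det|⁻¹ • ∫ x, g x := by
  have h := (measurableEmbedding_toLin' hA).integral_map (μ := volume) g
  rw [Real.map_matrix_volume_pi_eq_smul_volume_pi hA, integral_smul_measure,
    ENNReal.toReal_ofReal (abs_nonneg _), abs_inv] at h
  simpa using h.symm

lemma integrable_of_comp_mulVec {d : ℕ} {A : Mat d} (hA : A.det ≠ 0) {g : Vec d → ℂ}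
    (hg : Integrable (fun y => g (A *ᵥ y))) : Integrable g := by
  have h := (measurableEmbedding_toLin' hA).integrable_map_iff (μ := volume) (g := g)
  rw [Real.map_matrix_volume_pi_eq_smul_volume_pi hA, integrable_smul_measure
    (by simpa using hA) ENNReal.ofReal_ne_top] at h
  exact h.2 (by simpa [Function.comp_def] using hg)

/-- The Gaussian density in standardised coordinates. -/
lemma gaussDensity_standardise {d : ℕ} {A : Mat d} (hA : A.det ≠ 0) (θ y : Vec d) :
    gaussDensity d θ (A * Aᵀ) (A *ᵥ y + θ) =
      ((2 * Real.pi) ^ ((d : ℝ) / 2) * |A.det|)⁻¹ * Real.exp (-(∑ i, y i ^ 2) / 2) := by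
  have hu : IsUnit A.det := isUnit_iff_ne_zero.2 hA
  have hu' : IsUnit Aᵀ.det := by simpa using hu
  have h1 : (A * Aᵀ)⁻¹ *ᵥ (A *ᵥ y) = Aᵀ⁻¹ *ᵥ y := by
    rw [Matrix.mul_inv_rev, mulVec_mulVec, mul_assoc, nonsing_inv_mul _ hu, mul_one]
  have h2 : (A *ᵥ y) ⬝ᵥ (Aᵀ⁻¹ *ᵥ y) = ∑ i, y i ^ 2 := by
    rw [← vecMul_transpose, ← dotProduct_mulVec, mulVec_mulVec, mul_nonsing_inv _ hu', one_mulVec]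
    simp [dotProduct, sq]
  rw [gaussDensity, add_sub_cancel_right, h1, h2, det_mul, det_transpose, ← sq, Real.sqrt_sq_eq_abs]

lemma dotProduct_mul_transpose {d : ℕ} (A : Mat d) (u : Vec d) :
    u ⬝ᵥ ((A * Aᵀ) *ᵥ u) = ∑ i, (Aᵀ *ᵥ u) i ^ 2 := by
  rw [← mulVec_mulVec, dotProduct_mulVec, ← mulVec_transpose]
  simp [dotProduct, sq]

/-- The characteristic function of the Gaussian density. -/
lemma gaussDensity_fourier {d : ℕ} {M : Mat d} (hM : M.PosDef) (θ u : Vec d) :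
    Integrable (fun x => Complex.exp (Complex.I * ↑(u ⬝ᵥ x)) * (gaussDensity d θ M x : ℂ)) ∧
    ∫ x, Complex.exp (Complex.I * ↑(u ⬝ᵥ x)) * (gaussDensity d θ M x : ℂ) =
      Complex.exp (Complex.I * ↑(u ⬝ᵥ θ) - ↑(u ⬝ᵥ (M *ᵥ u)) / 2) := by
  obtain ⟨A, rfl, hA⟩ := hM.exists_mul_transpose
  set g : Vec d → ℂ := fun x =>
    Complex.exp (Complex.I * ↑(u ⬝ᵥ x)) * (gaussDensity d θ (A * Aᵀ) x : ℂ) with hg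
  set v := Aᵀ *ᵥ u with hv
  set N : ℂ := (((2 * Real.pi) ^ ((d : ℝ) / 2) * |A.det| : ℝ) : ℂ) with hN
  have hpi : (0 : ℝ) < (2 * Real.pi) ^ ((d : ℝ) / 2) := by positivity
  have hdet : 0 < |A.det| := abs_pos.2 hA
  have key : ∀ y, g (A *ᵥ y + θ) = N⁻¹ * Complex.exp (Complex.I * ↑(u ⬝ᵥ θ)) *
      Complex.exp (-(1 / 2 : ℂ) * ∑ i, (y i : ℂ) ^ 2 + ∑ i, (Complex.I * v i) * y i) := by
    intro y
    have h1 : u ⬝ᵥ (A *ᵥ y + θ) = ∑ i, v i * y i + u ⬝ᵥ θ := by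
      rw [dotProduct_add, dotProduct_mulVec, ← mulVec_transpose]; rfl
    simp only [hg, gaussDensity_standardise hA, h1, hN]
    push_cast
    rw [mul_comm, mul_assoc, mul_assoc, ← Complex.exp_add, ← Complex.exp_add]
    congr 2
    simp only [mul_assoc, ← Finset.mul_sum]
    ring
  have hb : 0 < (1 / 2 : ℂ).re := by norm_num
  have hint := (GaussianFourier.integrable_cexp_neg_mul_sum_add hb
    (fun i => Complex.I * v i)).const_mul (N⁻¹ * Complex.exp (Complex.I * ↑(u ⬝ᵥ θ)))
  have hval := GaussianFourier.integral_cexp_neg_mul_sum_add hb (fun i => Complex.I * v i)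
  constructor
  · have h1 : Integrable (fun x => g (x + θ)) :=
      integrable_of_comp_mulVec hA (g := fun x => g (x + θ)) (by simpa only [key] using hint)
    simpa using h1.comp_sub_right θ
  · have h1 := integral_comp_mulVec hA (fun x => g (x + θ))
    simp only [key] at h1
    rw [integral_const_mul, hval, integral_add_right_eq_self] at h1
    have h2 : ∫ x, g x = |A.det| • (|A.det|⁻¹ • ∫ x, g x) := by
      rw [smul_smul, mul_inv_cancel₀ hdet.ne', one_smul]
    rw [h2, ← h1, dotProduct_mul_transpose, Complex.exp_sub]
    have h3 : (Real.pi / (1 / 2 : ℂ)) ^ (Fintype.card (Fin d) / 2 : ℂ) =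
        (((2 * Real.pi) ^ ((d : ℝ) / 2) : ℝ) : ℂ) := by
      rw [Complex.ofReal_cpow (by positivity)]
      simp [mul_comm]
    have h4 : (∑ i, (Complex.I * (v i : ℂ)) ^ 2) / (4 * (1 / 2)) =
        -((∑ i, v i ^ 2 : ℝ) / 2 : ℂ) := by
      simp only [mul_pow, Complex.I_sq, ← Finset.mul_sum]
      push_cast
      ring
    rw [h3, h4, Complex.exp_neg, hN, Complex.real_smul]
    push_cast
    have : ((|A.det| : ℝ) : ℂ) ≠ 0 := by exact_mod_cast hdet.ne'
    have : (((2 * Real.pi) ^ ((d : ℝ) / 2) : ℝ) : ℂ) ≠ 0 := by exact_mod_cast hpi.ne'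
    field_simp
    rfl

/-- The characteristic function of a Gaussian along the direction `u`, as a function of `z = i s`. -/
lemma integral_exp_mul_gaussFam {d : ℕ} {p : Vec d × Mat d} (hM : p.2.PosDef) (u : Vec d) (s : ℝ) :
    Integrable (fun x => Complex.exp (Complex.I * ↑((s • u) ⬝ᵥ x)) * (gaussFam d p x : ℂ)) ∧
    ∫ x, Complex.exp (Complex.I * ↑((s • u) ⬝ᵥ x)) * (gaussFam d p x : ℂ) =
      Complex.exp (↑(u ⬝ᵥ p.1) * (Complex.I * s) +
        ↑(u ⬝ᵥ (p.2 *ᵥ u) / 2) * (Complex.I * s) ^ 2) := by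
  obtain ⟨h1, h2⟩ := gaussDensity_fourier hM p.1 (s • u)
  refine ⟨h1, h2.trans ?_⟩
  congr 1
  simp only [smul_dotProduct, mulVec_smul, dotProduct_smul, smul_eq_mul, mul_pow, Complex.I_sq]
  push_cast
  ring

lemma Mix.integral_exp_mul_density {d k : ℕ} (G : Mix (Vec d × Mat d) k)
    (hG : ∀ i, (G.atom i).2.PosDef) (u : Vec d) (s : ℝ) :
    Integrable (fun x => Complex.exp (Complex.I * ↑((s • u) ⬝ᵥ x)) *
      (Mix.density (gaussFam d) G x : ℂ)) ∧
    ∫ x, Complex.exp (Complex.I * ↑((s • u) ⬝ᵥ x)) * (Mix.density (gaussFam d) G x : ℂ) =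
      ∑ i, (G.w i : ℂ) * Complex.exp (↑(u ⬝ᵥ (G.atom i).1) * (Complex.I * s) +
        ↑(u ⬝ᵥ ((G.atom i).2 *ᵥ u) / 2) * (Complex.I * s) ^ 2) := by
  have h : ∀ x, Complex.exp (Complex.I * ↑((s • u) ⬝ᵥ x)) * (Mix.density (gaussFam d) G x : ℂ) =
      ∑ i, (G.w i : ℂ) * (Complex.exp (Complex.I * ↑((s • u) ⬝ᵥ x)) *
        (gaussFam d (G.atom i) x : ℂ)) := by
    intro x
    simp only [Mix.density, Complex.ofReal_sum, Complex.ofReal_mul, Finset.mul_sum]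
    exact Finset.sum_congr rfl fun i _ => by ring
  have hi : ∀ i ∈ Finset.univ, Integrable (fun x => (G.w i : ℂ) *
      (Complex.exp (Complex.I * ↑((s • u) ⬝ᵥ x)) * (gaussFam d (G.atom i) x : ℂ))) :=
    fun i _ => (integral_exp_mul_gaussFam (hG i) u s).1.const_mul _
  simp only [h]
  refine ⟨integrable_finsetSum _ hi, ?_⟩
  rw [integral_finsetSum _ hi]
  refine Finset.sum_congr rfl fun i _ => ?_
  rw [integral_const_mul, (integral_exp_mul_gaussFam (hG i) u s).2]

/-- The total variation distance controls differences of characteristic functions. -/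
lemma norm_sub_le_two_mul_TV {d k k' : ℕ} (G : Mix (Vec d × Mat d) k) (G' : Mix (Vec d × Mat d) k')
    (hG : ∀ i, (G.atom i).2.PosDef) (hG' : ∀ i, (G'.atom i).2.PosDef) (u : Vec d) (s : ℝ) :
    ‖∑ i, (G.w i : ℂ) * Complex.exp (↑(u ⬝ᵥ (G.atom i).1) * (Complex.I * s) +
        ↑(u ⬝ᵥ ((G.atom i).2 *ᵥ u) / 2) * (Complex.I * s) ^ 2) -
      ∑ i, (G'.w i : ℂ) * Complex.exp (↑(u ⬝ᵥ (G'.atom i).1) * (Complex.I * s) +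
        ↑(u ⬝ᵥ ((G'.atom i).2 *ᵥ u) / 2) * (Complex.I * s) ^ 2)‖ ≤
      2 * TV Set.univ (Mix.density (gaussFam d) G) (Mix.density (gaussFam d) G') := by
  obtain ⟨h1, h2⟩ := G.integral_exp_mul_density hG u s
  obtain ⟨h1', h2'⟩ := G'.integral_exp_mul_density hG' u s
  rw [← h2, ← h2', ← integral_sub h1 h1', TV, Measure.restrict_univ, ← mul_assoc,
    show (2 : ℝ) * (1 / 2) = 1 by norm_num, one_mul]
  refine (norm_integral_le_integral_norm _).trans (le_of_eq ?_)
  refine integral_congr_ae (Filter.Eventually.of_forall fun x => ?_)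
  simp only
  rw [← mul_sub, norm_mul, mul_comm Complex.I, Complex.norm_exp_ofReal_mul_I, one_mul,
    ← Complex.ofReal_sub, Complex.norm_real, Real.norm_eq_abs]

open Filter Asymptotics in
lemma polyExp_isLittleO {a a' b b' : ℝ} {n n' : ℕ}
    (h : toLex (b, toLex (a, n)) < toLex (b', toLex (a', n'))) :
    (fun x : ℝ => x ^ n * Real.exp (a * x + b * x ^ 2)) =o[atTop]
      fun x : ℝ => x ^ n' * Real.exp (a' * x + b' * x ^ 2) := by
  have aux : ∀ ε : ℝ, 0 < ε → (∀ᶠ x : ℝ in atTop, (a + ε) * x + b * x ^ 2 ≤ a' * x + b' * x ^ 2) →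
      (fun x : ℝ => x ^ n * Real.exp (a * x + b * x ^ 2)) =o[atTop]
        fun x : ℝ => x ^ n' * Real.exp (a' * x + b' * x ^ 2) := by
    intro ε hε hev
    have h1 := (isLittleO_pow_exp_pos_mul_atTop n hε).mul_isBigO
      (isBigO_refl (fun x : ℝ => Real.exp (a * x + b * x ^ 2)) atTop)
    refine h1.trans_isBigO (IsBigO.of_bound 1 ?_)
    filter_upwards [hev, eventually_ge_atTop 1] with x hx hx1
    rw [← Real.exp_add, Real.norm_of_nonneg (Real.exp_pos _).le, one_mul,
      Real.norm_of_nonneg (by positivity)]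
    calc Real.exp (ε * x + (a * x + b * x ^ 2)) ≤ Real.exp (a' * x + b' * x ^ 2) :=
          Real.exp_le_exp.2 (by linarith)
      _ ≤ _ := le_mul_of_one_le_left (Real.exp_pos _).le (one_le_pow₀ hx1)
  rw [Prod.Lex.toLex_lt_toLex] at h
  rcases h with h | ⟨hb, h⟩
  · refine aux 1 one_pos ?_
    simp only at h
    filter_upwards [eventually_ge_atTop 0, eventually_ge_atTop ((a + 1 - a') / (b' - b))]
      with x hx0 hx
    rw [div_le_iff₀ (by linarith)] at hx
    nlinarith
  · rw [Prod.Lex.toLex_lt_toLex] at h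
    simp only at hb h
    subst hb
    rcases h with h | ⟨ha, h⟩
    · exact aux (a' - a) (by linarith) (Eventually.of_forall fun x => by linarith)
    · subst ha
      exact (isLittleO_pow_pow_atTop_of_lt h).mul_isBigO (isBigO_refl _ _)

open Filter Asymptotics in
/-- The functions `x ^ n * exp (a x + b x²)` with distinct parameters are linearly independent. -/
lemma polyExp_coeff_eq_zero {κ : Type*} [Fintype κ] {a b : κ → ℝ} {n : κ → ℕ}
    (hinj : Function.Injective fun k => (b k, a k, n k)) (q : κ → ℝ)
    (h : ∀ x : ℝ, ∑ k, q k * (x ^ n k * Real.exp (a k * x + b k * x ^ 2)) = 0) : q = 0 := by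
  classical
  by_contra hq
  have hne : (Finset.univ.filter fun k => q k ≠ 0).Nonempty := by
    obtain ⟨k, hk⟩ := Function.ne_iff.1 hq
    exact ⟨k, by simpa using hk⟩
  obtain ⟨k, hk, hmax⟩ := Finset.exists_max_image _
    (fun k => toLex (b k, toLex (a k, n k))) hne
  have hk0 : q k ≠ 0 := by simpa using hk
  set F : κ → ℝ → ℝ := fun k x => x ^ n k * Real.exp (a k * x + b k * x ^ 2) with hF
  have hsum : (fun x => ∑ j ∈ Finset.univ.erase k, q j * F j x) =o[atTop] F k := by
    refine IsLittleO.fun_sum fun j hj => ?_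
    by_cases hj0 : q j = 0
    · simp [hj0]
    · refine (polyExp_isLittleO
        (lt_of_le_of_ne (hmax j (by simpa using hj0)) fun he => ?_)).const_mul_left _
      refine Finset.ne_of_mem_erase hj (hinj ?_)
      simpa [Prod.ext_iff] using he
  have heq : (fun x => ∑ j ∈ Finset.univ.erase k, q j * F j x) = fun x => -q k * F k x := by
    funext x
    have := Finset.add_sum_erase Finset.univ (fun j => q j * F j x) (Finset.mem_univ k)
    have h0 := h x
    simp only [hF] at this h0 ⊢
    linarith
  rw [heq, isLittleO_const_mul_left_iff (neg_ne_zero.2 hk0)] at hsum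
  refine isLittleO_irrefl (Eventually.frequently ?_) hsum
  filter_upwards [eventually_gt_atTop 0] with x hx
  simp only [hF]
  positivity

/-- Evaluation of combinations of `z ^ n * exp (a z + b z²)` on the segment `z = i s`, `0 ≤ s ≤ 1`. -/
noncomputable def polyExpEval {κ : Type*} [Fintype κ] (a b : κ → ℝ) (n : κ → ℕ) :
    (κ → ℝ) →ₗ[ℝ] C(Set.Icc (0 : ℝ) 1, ℂ) where
  toFun q := ⟨fun s => ∑ k, (q k : ℂ) * ((Complex.I * (s : ℝ)) ^ n k *
    Complex.exp (a k * (Complex.I * (s : ℝ)) + b k * (Complex.I * (s : ℝ)) ^ 2)), by fun_prop⟩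
  map_add' q q' := by
    ext s
    simp [add_mul, Finset.sum_add_distrib]
  map_smul' c q := by
    ext s
    simp [mul_assoc, Finset.mul_sum]

lemma polyExpEval_apply {κ : Type*} [Fintype κ] (a b : κ → ℝ) (n : κ → ℕ) (q : κ → ℝ)
    (s : Set.Icc (0 : ℝ) 1) : polyExpEval a b n q s =
      ∑ k, (q k : ℂ) * ((Complex.I * (s : ℝ)) ^ n k *
        Complex.exp (a k * (Complex.I * (s : ℝ)) + b k * (Complex.I * (s : ℝ)) ^ 2)) := rfl

open Filter Topology in
lemma polyExpEval_injective {κ : Type*} [Fintype κ] {a b : κ → ℝ} {n : κ → ℕ}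
    (hinj : Function.Injective fun k => (b k, a k, n k)) :
    Function.Injective (polyExpEval a b n) := by
  rw [injective_iff_map_eq_zero]
  intro q hq
  refine polyExp_coeff_eq_zero hinj q fun x => ?_
  set f : ℂ → ℂ := fun z => ∑ k, (q k : ℂ) * ((Complex.I * z) ^ n k *
    Complex.exp (a k * (Complex.I * z) + b k * (Complex.I * z) ^ 2)) with hf
  have hfa : AnalyticOnNhd ℂ f Set.univ :=
    DifferentiableOn.analyticOnNhd (by fun_prop) isOpen_univ
  have hz : f = fun _ => 0 := by
    refine hfa.eq_of_frequently_eq (z₀ := 0) analyticOnNhd_const ?_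
    have ht : Tendsto (fun m : ℕ => ((1 / ((m : ℝ) + 1) : ℝ) : ℂ)) atTop (𝓝[≠] 0) := by
      refine tendsto_nhdsWithin_iff.2 ⟨?_, Eventually.of_forall fun m => ?_⟩
      · exact_mod_cast (Complex.continuous_ofReal.tendsto 0).comp
          (tendsto_one_div_add_atTop_nhds_zero_nat (𝕜 := ℝ))
      · exact Complex.ofReal_ne_zero.2 (by positivity : (1 / ((m : ℝ) + 1) : ℝ) ≠ 0)
    refine ht.frequently (Eventually.frequently (Eventually.of_forall fun m => ?_))
    have hm : (1 / ((m : ℝ) + 1) : ℝ) ∈ Set.Icc (0 : ℝ) 1 :=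
      ⟨by positivity, by rw [div_le_one (by positivity)]; linarith [(Nat.cast_nonneg m : (0 : ℝ) ≤ m)]⟩
    have := DFunLike.congr_fun hq (⟨_, hm⟩ : Set.Icc (0 : ℝ) 1)
    rwa [polyExpEval_apply] at this
  have hx := congrFun hz (-Complex.I * x)
  simp only [hf, ← mul_assoc, mul_neg, neg_mul, Complex.I_mul_I, neg_neg, one_mul] at hx
  have : ((∑ k, q k * (x ^ n k * Real.exp (a k * x + b k * x ^ 2)) : ℝ) : ℂ) = 0 := by
    push_cast
    simpa [mul_assoc] using hx
  exact_mod_cast this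

/-- Quantitative linear independence of `z ^ n * exp (a z + b z²)` on the segment `z = i s`. -/
lemma exists_coeff_bound {κ : Type*} [Fintype κ] {a b : κ → ℝ} {n : κ → ℕ}
    (hinj : Function.Injective fun k => (b k, a k, n k)) :
    ∃ K > 0, ∀ (q : κ → ℝ) (η : ℝ), (∀ s ∈ Set.Icc (0 : ℝ) 1,
      ‖∑ k, (q k : ℂ) * ((Complex.I * s) ^ n k *
        Complex.exp (a k * (Complex.I * s) + b k * (Complex.I * s) ^ 2))‖ ≤ η) →
      ∀ k, |q k| ≤ K * η := by
  obtain ⟨K, hK, hanti⟩ := (polyExpEval a b n).exists_antilipschitzWith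
    (LinearMap.ker_eq_bot.2 (polyExpEval_injective hinj))
  refine ⟨K, hK, fun q η h k => ?_⟩
  have hη : 0 ≤ η := (norm_nonneg _).trans (h 0 (by simp))
  have h1 : ‖polyExpEval a b n q‖ ≤ η :=
    (ContinuousMap.norm_le _ hη).2 fun s => by
      rw [polyExpEval_apply]
      exact h s s.2
  have h2 : ‖q‖ ≤ K * ‖polyExpEval a b n q‖ := by
    simpa using hanti.le_mul_dist q 0
  exact ((norm_le_pi_norm q k).trans h2).trans (by gcongr)

/-- The coefficient of `z ^ α` in `exp (a z + b z²)`. -/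
noncomputable def expCoeff (α : ℕ) (a b : ℝ) : ℝ :=
  ∑ n ∈ Finset.filter (fun n : ℕ × ℕ => n.1 + 2 * n.2 = α)
    (Finset.range (α + 1) ×ˢ Finset.range (α + 1)),
    a ^ n.1 * b ^ n.2 / (n.1.factorial * n.2.factorial : ℝ)

lemma ssysEq_iff {m r : ℕ} {c a b : Fin m → ℝ} :
    SsysEq m r c a b ↔ ∀ α, 1 ≤ α → α ≤ r → ∑ j, c j ^ 2 * expCoeff α (a j) (b j) = 0 := by
  simp only [SsysEq, expCoeff, Finset.mul_sum, mul_div_assoc, mul_assoc]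

lemma expCoeff_zero (a b : ℝ) : expCoeff 0 a b = 1 := by
  simp [expCoeff, Finset.sum_filter]

lemma expCoeff_one (a b : ℝ) : expCoeff 1 a b = a := by
  simp [expCoeff, Finset.sum_filter, Finset.sum_product, Finset.sum_range_succ]

lemma expCoeff_two (a b : ℝ) : expCoeff 2 a b = a ^ 2 / 2 + b := by
  simp [expCoeff, Finset.sum_filter, Finset.sum_product, Finset.sum_range_succ]
  ring

lemma expCoeff_three (a b : ℝ) : expCoeff 3 a b = a ^ 3 / 6 + a * b := by
  simp [expCoeff, Finset.sum_filter, Finset.sum_product, Finset.sum_range_succ, Nat.factorial]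
  ring

lemma expCoeff_four_zero (b : ℝ) : expCoeff 4 0 b = b ^ 2 / 2 := by
  simp [expCoeff, Finset.sum_filter, Finset.sum_product, Finset.sum_range_succ, Nat.factorial]

lemma expCoeff_scale (α : ℕ) (l a b : ℝ) :
    expCoeff α (l * a) (l ^ 2 * b) = l ^ α * expCoeff α a b := by
  simp only [expCoeff, Finset.mul_sum]
  refine Finset.sum_congr rfl fun n hn => ?_
  rw [← (Finset.mem_filter.1 hn).2, mul_pow, mul_pow, pow_add, pow_mul]
  ring

@[fun_prop]
lemma continuous_expCoeff (α : ℕ) : Continuous fun p : ℝ × ℝ => expCoeff α p.1 p.2 := by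
  unfold expCoeff
  fun_prop

/-- Taylor remainder of `exp (a z + b z²)`, where `a` has weight one and `b` has weight two. -/
lemma norm_exp_sub_sum_expCoeff_le {a b ρ : ℝ} (r : ℕ) (hρ : ρ ≤ 1) (hρ0 : 0 ≤ ρ) (ha : |a| ≤ ρ)
    (hb : |b| ≤ ρ ^ 2) {z : ℂ} (hz : ‖z‖ ≤ 1) :
    ‖Complex.exp (a * z + b * z ^ 2) - ∑ α ∈ Finset.range (r + 1), z ^ α * (expCoeff α a b : ℂ)‖ ≤
      Real.exp 2 * ρ ^ (r + 1) := by
  set t : ℕ × ℕ → ℂ := fun n =>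
    ((a * z) ^ n.1 / (n.1.factorial : ℂ)) * ((b * z ^ 2) ^ n.2 / (n.2.factorial : ℂ)) with ht
  set e : ℕ × ℕ → ℝ := fun n =>
    ((1 : ℝ) ^ n.1 / (n.1.factorial : ℝ)) * ((1 : ℝ) ^ n.2 / (n.2.factorial : ℝ)) with he
  set F := Finset.filter (fun n : ℕ × ℕ => n.1 + 2 * n.2 ≤ r)
    (Finset.range (r + 1) ×ˢ Finset.range (r + 1)) with hF
  have hexp : ∀ x : ℂ, HasSum (fun n : ℕ => x ^ n / (n.factorial : ℂ)) (Complex.exp x) := by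
    intro x
    rw [Complex.exp_eq_exp_ℂ]
    exact NormedSpace.expSeries_div_hasSum_exp x
  have hexp' : HasSum (fun n : ℕ => (1 : ℝ) ^ n / (n.factorial : ℝ)) (Real.exp 1) := by
    rw [Real.exp_eq_exp_ℝ]
    exact NormedSpace.expSeries_div_hasSum_exp 1
  have hnorm : ∀ x : ℂ, Summable fun n : ℕ => ‖x ^ n / (n.factorial : ℂ)‖ := fun x =>
    (hexp x).summable.norm
  have ht_sum : HasSum t (Complex.exp (a * z + b * z ^ 2)) := by
    rw [Complex.exp_add]
    have hs := summable_mul_of_summable_norm (hnorm (a * z)) (hnorm (b * z ^ 2))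
    have := HasSum.mul (hexp (a * z)) (hexp (b * z ^ 2)) hs
    exact this
  have he_sum : HasSum e (Real.exp 2) := by
    rw [show (2 : ℝ) = 1 + 1 by norm_num, Real.exp_add]
    have hs := summable_mul_of_summable_norm hexp'.summable.norm hexp'.summable.norm
    exact hexp'.mul hexp' hs
  have hFsum : ∑ n ∈ F, t n = ∑ α ∈ Finset.range (r + 1), z ^ α * (expCoeff α a b : ℂ) := by
    rw [← Finset.sum_fiberwise_of_maps_to (t := Finset.range (r + 1))
      (g := fun n : ℕ × ℕ => n.1 + 2 * n.2) (fun n hn => by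
        have := (Finset.mem_filter.1 hn).2
        exact Finset.mem_range.2 (by omega))]
    refine Finset.sum_congr rfl fun α hα => ?_
    have hset : F.filter (fun n : ℕ × ℕ => n.1 + 2 * n.2 = α) =
        Finset.filter (fun n : ℕ × ℕ => n.1 + 2 * n.2 = α)
          (Finset.range (α + 1) ×ˢ Finset.range (α + 1)) := by
      ext n
      simp only [hF, Finset.mem_filter, Finset.mem_product, Finset.mem_range] at hα ⊢
      omega
    rw [hset, expCoeff, Complex.ofReal_sum, Finset.mul_sum]
    refine Finset.sum_congr rfl fun n hn => ?_
    rw [← (Finset.mem_filter.1 hn).2, ht]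
    push_cast
    ring
  have hsplit := ht_sum.sub (hasSum_sum_of_ne_finset_zero (f := fun n => if n ∈ F then t n else 0)
    (s := F) fun n hn => by simp [hn])
  rw [Finset.sum_congr rfl (g := t) fun n hn => by simp [hn], hFsum] at hsplit
  rw [mul_comm (Real.exp 2)]
  refine hsplit.norm_le_of_bounded (he_sum.mul_left _) fun n => ?_
  by_cases hn : n ∈ F
  · simp only [hn, if_true, sub_self, norm_zero]
    positivity
  · simp only [hn, if_false, sub_zero]
    have hn' : r + 1 ≤ n.1 + 2 * n.2 := by
      simp only [hF, Finset.mem_filter, Finset.mem_product, Finset.mem_range] at hn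
      omega
    have haz : ‖(a : ℂ) * z‖ ≤ ρ := by
      rw [norm_mul, Complex.norm_real, Real.norm_eq_abs]
      exact (mul_le_mul ha hz (norm_nonneg _) hρ0).trans_eq (mul_one _)
    have hbz : ‖(b : ℂ) * z ^ 2‖ ≤ ρ ^ 2 := by
      rw [norm_mul, Complex.norm_real, Real.norm_eq_abs, norm_pow]
      exact (mul_le_mul hb (pow_le_one₀ (norm_nonneg _) hz) (by positivity)
        (by positivity)).trans_eq (mul_one _)
    calc ‖t n‖ = ‖(a : ℂ) * z‖ ^ n.1 * ‖(b : ℂ) * z ^ 2‖ ^ n.2 * e n := by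
          simp only [ht, he, norm_mul, norm_div, norm_pow, Complex.norm_natCast, one_pow]
          ring
      _ ≤ ρ ^ n.1 * (ρ ^ 2) ^ n.2 * e n := by gcongr
      _ = ρ ^ (n.1 + 2 * n.2) * e n := by rw [pow_add, pow_mul]
      _ ≤ ρ ^ (r + 1) * e n :=
          mul_le_mul_of_nonneg_right (pow_le_pow_of_le_one hρ0 hρ hn') (by positivity)

/-- Solutions for `m` unknowns also arise for fewer unknowns, so `¬ NontrivSol m r` forces
rigidity for every family of at most `m` weighted atoms. -/
lemma eq_zero_of_not_nontrivSol {ι : Type*} {m r : ℕ} (h : ¬ NontrivSol m r) (hr : 4 ≤ r)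
    {J : Finset ι} (hJ : J.card ≤ m) {w a b : ι → ℝ} (hw : ∀ j ∈ J, 0 < w j)
    (hs : ∀ α, 1 ≤ α → α ≤ r → ∑ j ∈ J, w j * expCoeff α (a j) (b j) = 0) :
    ∀ j ∈ J, a j = 0 ∧ b j = 0 := by
  classical
  rcases J.eq_empty_or_nonempty with rfl | hne
  · simp
  have ha : ∀ j ∈ J, a j = 0 := by
    have hinj : Nonempty (J ↪ Fin m) := by
      rw [Function.Embedding.nonempty_iff_card_le]; simpa using hJ
    obtain ⟨e⟩ := hinj
    have : Nonempty J := hne.to_subtype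
    set τ : Fin m → J := Function.invFun e with hτ
    have hτs : Function.Surjective τ := Function.invFun_surjective e.injective
    set N : J → ℝ := fun j => ((Finset.univ.filter fun l => τ l = j).card : ℝ) with hN
    have hNpos : ∀ j, 0 < N j := fun j => by
      obtain ⟨l, hl⟩ := hτs j
      exact Nat.cast_pos.2 (Finset.card_pos.2 ⟨l, by simpa using hl⟩)
    have hq : ∀ l, 0 < w (τ l) / N (τ l) := fun l => div_pos (hw _ (τ l).2) (hNpos _)
    have hsum : ∀ g : J → ℝ, ∑ l, Real.sqrt (w (τ l) / N (τ l)) ^ 2 * g (τ l) =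
        ∑ j : J, w j * g j := by
      intro g
      rw [← Finset.sum_fiberwise Finset.univ τ]
      refine Finset.sum_congr rfl fun j _ => ?_
      rw [Finset.sum_congr rfl (g := fun _ => w j / N j * g j) fun l hl => by
        rw [Real.sq_sqrt (hq l).le, (Finset.mem_filter.1 hl).2], Finset.sum_const, nsmul_eq_mul]
      have := (hNpos j).ne'
      change N j * _ = _
      field_simp
    by_contra! hcon
    obtain ⟨j, hj, hja⟩ := hcon
    obtain ⟨l, hl⟩ := hτs ⟨j, hj⟩
    refine h ⟨fun l => Real.sqrt (w (τ l) / N (τ l)), fun l => a (τ l), fun l => b (τ l),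
      ssysEq_iff.2 fun α h1 h2 => ?_, fun l => (Real.sqrt_pos.2 (hq l)).ne', l, by simpa [hl]⟩
    rw [hsum fun j => expCoeff α (a j) (b j)]
    exact (Finset.sum_coe_sort J fun j => w j * expCoeff α (a j) (b j)).trans (hs α h1 h2)
  have h4 := hs 4 (by norm_num) hr
  rw [Finset.sum_eq_zero_iff_of_nonneg fun j hj => by
    rw [ha j hj, expCoeff_four_zero]; have := hw j hj; positivity] at h4
  intro j hj
  refine ⟨ha j hj, ?_⟩
  have := h4 j hj
  rw [ha j hj, expCoeff_four_zero] at this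
  simpa [(hw j hj).ne'] using this

lemma nontrivSol_of_le_three {m r : ℕ} (hm : 2 ≤ m) (hr : r ≤ 3) : NontrivSol m r := by
  obtain ⟨m, rfl⟩ := Nat.exists_eq_add_of_le' hm
  refine ⟨Fin.cons (Real.sqrt (m + 1)) fun _ => 1, Fin.cons 1 fun _ => -1, fun _ => -1 / 2,
    ssysEq_iff.2 fun α h1 h2 => ?_, fun j => ?_, 0, by simp⟩
  · have hs : Real.sqrt (m + 1) ^ 2 = (m : ℝ) + 1 := Real.sq_sqrt (by positivity)
    have : α = 1 ∨ α = 2 ∨ α = 3 := by omega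
    rcases this with rfl | rfl | rfl
    · simp [Fin.sum_univ_succ, expCoeff_one, hs]
    · simp [Fin.sum_univ_succ, expCoeff_two, hs]; ring
    · simp [Fin.sum_univ_succ, expCoeff_three, hs]; ring
  · refine Fin.cases ?_ (fun i => ?_) j
    · simp only [Fin.cons_zero]; positivity
    · simp

/-- Weighted-homogeneous lower bound for the grouped moment sums. -/
lemma exists_moment_lower_bound {K k₀ m r : ℕ} (σ : Fin K → Fin k₀)
    (hcard : ∀ i, (Finset.univ.filter fun j => σ j = i).card ≤ m)
    (h : ¬ NontrivSol m r) (hr : 4 ≤ r) {c₀ : ℝ} (hc₀ : 0 < c₀) :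
    ∃ c > 0, ∀ (w a b : Fin K → ℝ) (ρ : ℝ), (∀ j, c₀ ≤ w j ∧ w j ≤ 1) → 0 < ρ → ρ ≤ 1 →
      ∑ j, (a j ^ 2 + |b j|) = ρ ^ 2 →
      c * ρ ^ r ≤ ∑ i, ∑ α ∈ Finset.Icc 1 r,
        |∑ j with σ j = i, w j * expCoeff α (a j) (b j)| := by
  set F : (Fin K → ℝ) × (Fin K → ℝ) × (Fin K → ℝ) → ℝ := fun p => ∑ i, ∑ α ∈ Finset.Icc 1 r,
    |∑ j with σ j = i, p.1 j * expCoeff α (p.2.1 j) (p.2.2 j)| with hF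
  set S : Set ((Fin K → ℝ) × (Fin K → ℝ) × (Fin K → ℝ)) :=
    {p | (∀ j, c₀ ≤ p.1 j ∧ p.1 j ≤ 1) ∧ ∑ j, (p.2.1 j ^ 2 + |p.2.2 j|) = 1} with hS
  have hFc : Continuous F := by
    refine continuous_finsetSum _ fun i _ => continuous_finsetSum _ fun α _ => Continuous.abs ?_
    refine continuous_finsetSum _ fun j _ => Continuous.mul (by fun_prop) ?_
    exact (continuous_expCoeff α).comp (f := fun p : (Fin K → ℝ) × (Fin K → ℝ) × (Fin K → ℝ) =>
      (p.2.1 j, p.2.2 j)) (by fun_prop)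
  have hSc : IsCompact S := by
    refine IsCompact.of_isClosed_subset (isCompact_Icc
      (a := ((fun _ => c₀, fun _ => -1, fun _ => -1) : (Fin K → ℝ) × (Fin K → ℝ) × (Fin K → ℝ)))
      (b := ((fun _ => 1, fun _ => 1, fun _ => 1) : (Fin K → ℝ) × (Fin K → ℝ) × (Fin K → ℝ)))) ?_ ?_
    · refine IsClosed.inter
        (s₁ := {p : (Fin K → ℝ) × (Fin K → ℝ) × (Fin K → ℝ) | ∀ j, c₀ ≤ p.1 j ∧ p.1 j ≤ 1}) ?_
        (isClosed_eq (by fun_prop) continuous_const)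
      rw [Set.ofPred_forall]
      exact isClosed_iInter fun j => isClosed_Icc.preimage
        (f := fun p : (Fin K → ℝ) × (Fin K → ℝ) × (Fin K → ℝ) => p.1 j) (by fun_prop)
    · rintro p ⟨hw, hs⟩
      have hle : ∀ j, p.2.1 j ^ 2 + |p.2.2 j| ≤ 1 := fun j => hs ▸
        Finset.single_le_sum (f := fun j => p.2.1 j ^ 2 + |p.2.2 j|) (fun _ _ => by positivity)
          (Finset.mem_univ j)
      have ha : ∀ j, |p.2.1 j| ≤ 1 := fun j => by
        rw [← sq_le_one_iff_abs_le_one]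
        linarith [hle j, abs_nonneg (p.2.2 j)]
      have hb : ∀ j, |p.2.2 j| ≤ 1 := fun j => by linarith [hle j, sq_nonneg (p.2.1 j)]
      exact ⟨⟨fun j => (hw j).1, fun j => (abs_le.1 (ha j)).1, fun j => (abs_le.1 (hb j)).1⟩,
        ⟨fun j => (hw j).2, fun j => (abs_le.1 (ha j)).2, fun j => (abs_le.1 (hb j)).2⟩⟩
  have hpos : ∀ p ∈ S, 0 < F p := by
    rintro p ⟨hw, hs⟩
    refine lt_of_le_of_ne (by positivity) fun h0 => ?_
    have hzero : ∀ i, ∀ α ∈ Finset.Icc 1 r,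
        ∑ j with σ j = i, p.1 j * expCoeff α (p.2.1 j) (p.2.2 j) = 0 := by
      intro i α hα
      have h1 := (Finset.sum_eq_zero_iff_of_nonneg fun i _ => by positivity).1 h0.symm i
        (Finset.mem_univ i)
      exact abs_eq_zero.1 ((Finset.sum_eq_zero_iff_of_nonneg fun i _ => by positivity).1 h1 α hα)
    have hab : ∀ j, p.2.1 j = 0 ∧ p.2.2 j = 0 := fun j =>
      eq_zero_of_not_nontrivSol h hr (hcard (σ j)) (fun j _ => hc₀.trans_le (hw j).1)
        (fun α h1 h2 => hzero (σ j) α (Finset.mem_Icc.2 ⟨h1, h2⟩)) j (by simp)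
    simp [hab] at hs
  obtain ⟨c, hc, hcF⟩ : ∃ c > 0, ∀ p ∈ S, c ≤ F p := by
    rcases S.eq_empty_or_nonempty with he | hne
    · exact ⟨1, one_pos, by simp [he]⟩
    · obtain ⟨p, hp, hmin⟩ := hSc.exists_isMinOn hne hFc.continuousOn
      exact ⟨F p, hpos p hp, fun p' hp' => hmin hp'⟩
  refine ⟨c, hc, fun w a b ρ hw hρ hρ1 hs => ?_⟩
  have hmem : ((w, fun j => ρ⁻¹ * a j, fun j => ρ⁻¹ ^ 2 * b j) :
      (Fin K → ℝ) × (Fin K → ℝ) × (Fin K → ℝ)) ∈ S := by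
    refine ⟨hw, ?_⟩
    simp only [mul_pow, abs_mul, abs_pow, abs_inv, abs_of_pos hρ, ← mul_add, ← Finset.mul_sum, hs]
    field_simp
  refine (mul_le_mul_of_nonneg_right (hcF _ hmem) (by positivity)).trans ?_
  simp only [hF, Finset.sum_mul]
  refine Finset.sum_le_sum fun i _ => Finset.sum_le_sum fun α hα => ?_
  simp only [expCoeff_scale, mul_left_comm (w _), ← Finset.mul_sum]
  rw [abs_mul, abs_of_pos (by positivity : 0 < ρ⁻¹ ^ α), mul_right_comm]
  refine mul_le_of_le_one_left (abs_nonneg _) ?_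
  rw [inv_pow, inv_mul_le_one₀ (by positivity)]
  exact pow_le_pow_of_le_one hρ.le hρ1 (Finset.mem_Icc.1 hα).2

/-- Inverse bound for characteristic functions along one direction. -/
lemma exists_one_dim_bound {K k₀ m r : ℕ} {a₀ b₀ : Fin k₀ → ℝ}
    (hinj : Function.Injective fun i => (b₀ i, a₀ i)) (hb₀ : ∀ i, 0 ≤ b₀ i) (σ : Fin K → Fin k₀)
    (hcard : ∀ i, (Finset.univ.filter fun j => σ j = i).card ≤ m)
    (h : ¬ NontrivSol m r) (hr : 4 ≤ r) {c₀ : ℝ} (hc₀ : 0 < c₀) :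
    ∃ δ > 0, ∃ C > 0, ∀ (w a b : Fin K → ℝ) (p : Fin k₀ → ℝ) (η : ℝ),
      (∀ j, c₀ ≤ w j ∧ w j ≤ 1) → (∀ j, |a j - a₀ (σ j)| ≤ δ) → (∀ j, |b j - b₀ (σ j)| ≤ δ) →
      (∀ s ∈ Set.Icc (0 : ℝ) 1,
        ‖∑ j, (w j : ℂ) * Complex.exp (a j * (Complex.I * s) + b j * (Complex.I * s) ^ 2) -
          ∑ i, (p i : ℂ) * Complex.exp (a₀ i * (Complex.I * s) + b₀ i * (Complex.I * s) ^ 2)‖ ≤ η) →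
      (∀ i, |∑ j with σ j = i, w j - p i| ≤ C * η) ∧
        ∀ j, |a j - a₀ (σ j)| ^ r + |b j - b₀ (σ j)| ^ r ≤ C * η := by
  obtain ⟨c, hc, hB⟩ := exists_moment_lower_bound σ hcard h hr hc₀
  obtain ⟨A, hA, hAb⟩ := exists_coeff_bound (κ := Fin k₀ × Fin (r + 1))
    (a := fun k => a₀ k.1) (b := fun k => b₀ k.1) (n := fun k => (k.2 : ℕ)) (by
      rintro ⟨i, α⟩ ⟨i', α'⟩ he
      simp only [Prod.mk.injEq] at he
      exact Prod.ext (hinj (Prod.ext he.1 he.2.1)) (Fin.ext he.2.2))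
  set D : ℝ := K * Real.exp 2 with hD
  have hD0 : 0 ≤ D := by positivity
  set N : ℝ := k₀ * r * A with hN
  have hN0 : 0 ≤ N := by positivity
  set ρ₀ : ℝ := min 1 (c / (2 * (N * D + 1))) with hρ₀
  have hρ₀pos : 0 < ρ₀ := by positivity
  refine ⟨min 1 (ρ₀ ^ 2 / (2 * (K + 1))), by positivity, A * (1 + 2 * D * N / c) + 4 * N / c,
    by positivity, fun w a b p η hw ha hb hη => ?_⟩
  have hη0 : 0 ≤ η := (norm_nonneg _).trans (hη 0 (by simp))
  set x : Fin K → ℝ := fun j => a j - a₀ (σ j) with hx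
  set y : Fin K → ℝ := fun j => b j - b₀ (σ j) with hy
  set ρ : ℝ := Real.sqrt (∑ j, (x j ^ 2 + |y j|)) with hρdef
  have hρ0 : 0 ≤ ρ := Real.sqrt_nonneg _
  have hρsq : ∑ j, (x j ^ 2 + |y j|) = ρ ^ 2 := (Real.sq_sqrt (by positivity)).symm
  have hterm : ∀ j, x j ^ 2 + |y j| ≤ ρ ^ 2 := fun j => hρsq ▸
    Finset.single_le_sum (f := fun j => x j ^ 2 + |y j|) (fun _ _ => by positivity)
      (Finset.mem_univ j)
  have hρle : ρ ≤ ρ₀ := by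
    refine (pow_le_pow_iff_left₀ hρ0 hρ₀pos.le two_ne_zero).1 ?_
    rw [← hρsq]
    calc ∑ j, (x j ^ 2 + |y j|) ≤ ∑ _j : Fin K, 2 * (ρ₀ ^ 2 / (2 * (K + 1))) := by
          refine Finset.sum_le_sum fun j _ => ?_
          have h1 : |x j| ≤ 1 := (ha j).trans (min_le_left _ _)
          have h2 : |x j| ≤ ρ₀ ^ 2 / (2 * (K + 1)) := (ha j).trans (min_le_right _ _)
          have h3 : |y j| ≤ ρ₀ ^ 2 / (2 * (K + 1)) := (hb j).trans (min_le_right _ _)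
          have h4 : x j ^ 2 ≤ |x j| := by
            rw [← sq_abs]
            nlinarith [abs_nonneg (x j)]
          linarith
      _ = K * ρ₀ ^ 2 / (K + 1) := by
          simp only [Finset.sum_const, Finset.card_univ, Fintype.card_fin, nsmul_eq_mul]
          field_simp
      _ ≤ ρ₀ ^ 2 := by
          rw [div_le_iff₀ (by positivity)]
          nlinarith [sq_nonneg ρ₀]
  have hρ1 : ρ ≤ 1 := hρle.trans (min_le_left _ _)
  have hxρ : ∀ j, |x j| ≤ ρ := fun j =>
    abs_le_of_sq_le_sq (by linarith [hterm j, abs_nonneg (y j)]) hρ0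
  have hyρ : ∀ j, |y j| ≤ ρ ^ 2 := fun j => by linarith [hterm j, sq_nonneg (x j)]
  set q : Fin k₀ × Fin (r + 1) → ℝ := fun k =>
    ∑ j with σ j = k.1, w j * expCoeff k.2 (x j) (y j) - if (k.2 : ℕ) = 0 then p k.1 else 0 with hq
  have hqb : ∀ k, |q k| ≤ A * (η + D * ρ ^ (r + 1)) := by
    refine hAb q _ fun s hs => ?_
    set z : ℂ := Complex.I * s with hz
    have hz1 : ‖z‖ ≤ 1 := by
      rw [hz, norm_mul, Complex.norm_I, one_mul, Complex.norm_real, Real.norm_of_nonneg hs.1]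
      exact hs.2
    set E : Fin k₀ → ℂ := fun i => Complex.exp (a₀ i * z + b₀ i * z ^ 2) with hE
    have hE1 : ∀ i, ‖E i‖ ≤ 1 := by
      intro i
      rw [hE, Complex.norm_exp, Real.exp_le_one_iff]
      have : (a₀ i * z + b₀ i * z ^ 2).re = -(b₀ i * s ^ 2) := by
        have he : a₀ i * z + b₀ i * z ^ 2 =
            ((-(b₀ i * s ^ 2) : ℝ) : ℂ) + ((a₀ i * s : ℝ) : ℂ) * Complex.I := by
          rw [hz, mul_pow, Complex.I_sq]
          push_cast
          ring
        rw [he, Complex.add_re, Complex.ofReal_re, Complex.re_ofReal_mul, Complex.I_re]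
        ring
      rw [this]
      have := hb₀ i
      simp only [Left.neg_nonpos_iff]
      positivity
    have hid : ∑ k, (q k : ℂ) * (z ^ (k.2 : ℕ) * E k.1) =
        (∑ j, (w j : ℂ) * Complex.exp (a j * z + b j * z ^ 2) - ∑ i, (p i : ℂ) * E i) -
        ∑ j, (w j : ℂ) * E (σ j) * (Complex.exp (x j * z + y j * z ^ 2) -
          ∑ α ∈ Finset.range (r + 1), z ^ α * (expCoeff α (x j) (y j) : ℂ)) := by
      have h1 : ∀ j, Complex.exp (a j * z + b j * z ^ 2) =
          E (σ j) * Complex.exp (x j * z + y j * z ^ 2) := by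
        intro j
        rw [hE, ← Complex.exp_add]
        congr 1
        simp only [hx, hy]
        push_cast
        ring
      have h2 : ∑ k, (q k : ℂ) * (z ^ (k.2 : ℕ) * E k.1) =
          ∑ j, (w j : ℂ) * E (σ j) *
            ∑ α ∈ Finset.range (r + 1), z ^ α * (expCoeff α (x j) (y j) : ℂ) -
          ∑ i, (p i : ℂ) * E i := by
        rw [← Finset.sum_fiberwise Finset.univ σ, ← Finset.sum_sub_distrib, Fintype.sum_prod_type]
        refine Finset.sum_congr rfl fun i _ => ?_
        simp only [hq]
        push_cast
        simp only [sub_mul, Finset.sum_sub_distrib]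
        congr 1
        · simp only [Finset.sum_mul]
          rw [Finset.sum_comm]
          refine Finset.sum_congr rfl fun j hj => ?_
          rw [(Finset.mem_filter.1 hj).2, Finset.mul_sum,
            ← Fin.sum_univ_eq_sum_range (fun α => (w j : ℂ) * E i *
              (z ^ α * (expCoeff α (x j) (y j) : ℂ)))]
          exact Finset.sum_congr rfl fun α _ => by ring
        · rw [Finset.sum_eq_single 0 (fun α _ hα => by simp [hα]) (by simp)]
          simp
      rw [h2]
      simp only [h1, mul_sub, Finset.sum_sub_distrib, ← mul_assoc]
      ring
    rw [hid]
    refine (norm_sub_le _ _).trans (add_le_add (hη s hs) ?_)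
    refine (norm_sum_le _ _).trans ?_
    calc ∑ j, ‖(w j : ℂ) * E (σ j) * (Complex.exp (x j * z + y j * z ^ 2) -
          ∑ α ∈ Finset.range (r + 1), z ^ α * (expCoeff α (x j) (y j) : ℂ))‖
        ≤ ∑ _j : Fin K, Real.exp 2 * ρ ^ (r + 1) := by
          refine Finset.sum_le_sum fun j _ => ?_
          rw [norm_mul, norm_mul, Complex.norm_real,
            Real.norm_of_nonneg (hc₀.le.trans (hw j).1)]
          have h1 : w j * ‖E (σ j)‖ ≤ 1 := mul_le_one₀ (hw j).2 (norm_nonneg _) (hE1 _)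
          refine (mul_le_of_le_one_left (norm_nonneg _) h1).trans ?_
          exact norm_exp_sub_sum_expCoeff_le r hρ1 hρ0 (hxρ j) (hyρ j) hz1
      _ = D * ρ ^ (r + 1) := by
          simp only [Finset.sum_const, Finset.card_univ, Fintype.card_fin, nsmul_eq_mul, hD]
          ring
  have hρr : ρ ^ r ≤ 2 * N / c * η := by
    rcases hρ0.eq_or_lt with h0 | hpos
    · rw [← h0, zero_pow (by omega)]
      positivity
    have h1 := hB w x y ρ hw hpos hρ1 hρsq
    have h2 : ∑ i, ∑ α ∈ Finset.Icc 1 r, |∑ j with σ j = i, w j * expCoeff α (x j) (y j)| ≤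
        N * (η + D * ρ ^ (r + 1)) := by
      calc _ ≤ ∑ _i : Fin k₀, ∑ _α ∈ Finset.Icc 1 r, A * (η + D * ρ ^ (r + 1)) := by
            refine Finset.sum_le_sum fun i _ => Finset.sum_le_sum fun α hα => ?_
            obtain ⟨hα1, hα2⟩ := Finset.mem_Icc.1 hα
            have := hqb (i, ⟨α, by omega⟩)
            have hα0 : α ≠ 0 := by omega
            simpa only [hq, if_neg hα0, sub_zero] using this
        _ = _ := by
            simp only [Finset.sum_const, Finset.card_univ, Fintype.card_fin, nsmul_eq_mul,
              Nat.card_Icc, add_tsub_cancel_right, hN]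
            ring
    have h3 : N * D * ρ ≤ c / 2 := by
      have h4 : ρ * (2 * (N * D + 1)) ≤ c := by
        rw [← le_div_iff₀ (by positivity)]
        exact hρle.trans (min_le_right _ _)
      nlinarith
    have h5 : N * D * ρ * ρ ^ r ≤ c / 2 * ρ ^ r := by gcongr
    rw [div_mul_eq_mul_div, le_div_iff₀ hc]
    rw [pow_succ] at h2
    nlinarith
  have hsum : A * (1 + 2 * D * N / c) * η ≤ (A * (1 + 2 * D * N / c) + 4 * N / c) * η :=
    mul_le_mul_of_nonneg_right (le_add_of_nonneg_right (by positivity)) hη0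
  have hsum' : 4 * N / c * η ≤ (A * (1 + 2 * D * N / c) + 4 * N / c) * η :=
    mul_le_mul_of_nonneg_right (le_add_of_nonneg_left (by positivity)) hη0
  refine ⟨fun i => ?_, fun j => ?_⟩
  · have h1 := hqb (i, 0)
    simp only [hq, Fin.val_zero, expCoeff_zero, mul_one, if_true] at h1
    refine (h1.trans ?_).trans hsum
    have h2 : ρ ^ (r + 1) ≤ 2 * N / c * η :=
      (pow_le_pow_of_le_one hρ0 hρ1 (Nat.le_succ r)).trans hρr
    calc A * (η + D * ρ ^ (r + 1)) ≤ A * (η + D * (2 * N / c * η)) := by gcongr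
      _ = _ := by ring
  · refine le_trans ?_ hsum'
    have h1 : |x j| ^ r ≤ ρ ^ r := by gcongr; exact hxρ j
    have h2 : |y j| ^ r ≤ ρ ^ r := by
      gcongr
      exact (hyρ j).trans (by nlinarith)
    calc |x j| ^ r + |y j| ^ r ≤ 2 * (2 * N / c * η) := by linarith
      _ = _ := by ring

lemma vnorm_eq_norm {d : ℕ} (v : Vec d) : vnorm v = ‖WithLp.toLp 2 v‖ := by
  simp [vnorm, EuclideanSpace.norm_eq]

lemma mnorm_eq_norm {d : ℕ} (A : Mat d) :
    mnorm A = ‖WithLp.toLp 2 fun p : Fin d × Fin d => A p.1 p.2‖ := by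
  simp [mnorm, EuclideanSpace.norm_eq, Fintype.sum_prod_type]

lemma abs_apply_le_vnorm {d : ℕ} (v : Vec d) (i : Fin d) : |v i| ≤ vnorm v := by
  rw [vnorm_eq_norm]
  exact PiLp.norm_apply_le (WithLp.toLp 2 v) i

lemma abs_apply_le_mnorm {d : ℕ} (A : Mat d) (i j : Fin d) : |A i j| ≤ mnorm A := by
  rw [mnorm_eq_norm]
  exact PiLp.norm_apply_le (WithLp.toLp 2 fun p : Fin d × Fin d => A p.1 p.2) (i, j)

lemma parDist_nonneg {d₁ d₂ : ℕ} (p q : Vec d₁ × Mat d₂) : 0 ≤ parDist p q :=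
  add_nonneg (Real.sqrt_nonneg _) (Real.sqrt_nonneg _)

lemma parDist_comm {d₁ d₂ : ℕ} (p q : Vec d₁ × Mat d₂) : parDist p q = parDist q p := by
  simp only [parDist, vnorm, mnorm, Pi.sub_apply, Matrix.sub_apply]
  simp only [sub_sq_comm]

lemma parDist_triangle {d₁ d₂ : ℕ} (p q s : Vec d₁ × Mat d₂) :
    parDist p s ≤ parDist p q + parDist q s := by
  have h1 : vnorm (p.1 - s.1) ≤ vnorm (p.1 - q.1) + vnorm (q.1 - s.1) := by
    simp only [vnorm_eq_norm, WithLp.toLp_sub]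
    exact norm_sub_le_norm_sub_add_norm_sub _ _ _
  have h2 : mnorm (p.2 - s.2) ≤ mnorm (p.2 - q.2) + mnorm (q.2 - s.2) := by
    simp only [mnorm_eq_norm]
    exact norm_sub_le_norm_sub_add_norm_sub
      (WithLp.toLp 2 fun x : Fin d₂ × Fin d₂ => p.2 x.1 x.2)
      (WithLp.toLp 2 fun x : Fin d₂ × Fin d₂ => q.2 x.1 x.2)
      (WithLp.toLp 2 fun x : Fin d₂ × Fin d₂ => s.2 x.1 x.2)
  simp only [parDist]
  linarith

lemma parDist_pos {d₁ d₂ : ℕ} {p q : Vec d₁ × Mat d₂} (h : p ≠ q) : 0 < parDist p q := by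
  refine (parDist_nonneg p q).lt_of_ne fun h0 => h ?_
  have h1 : 0 ≤ vnorm (p.1 - q.1) := Real.sqrt_nonneg _
  have h2 : 0 ≤ mnorm (p.2 - q.2) := Real.sqrt_nonneg _
  rw [parDist] at h0
  refine Prod.ext (funext fun i => ?_) (Matrix.ext fun i j => ?_)
  · exact sub_eq_zero.1 (abs_nonpos_iff.1
      ((abs_apply_le_vnorm (p.1 - q.1) i).trans (by linarith)))
  · exact sub_eq_zero.1 (abs_nonpos_iff.1
      ((abs_apply_le_mnorm (p.2 - q.2) i j).trans (by linarith)))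

lemma vnorm_le_mul_norm {d : ℕ} (v : Vec d) : vnorm v ≤ d * ‖v‖ := by
  refine Real.sqrt_le_iff.2 ⟨by positivity, ?_⟩
  calc ∑ i, v i ^ 2 ≤ ∑ _i : Fin d, ‖v‖ ^ 2 := Finset.sum_le_sum fun i _ => by
        rw [← sq_abs]
        exact pow_le_pow_left₀ (abs_nonneg _) (norm_le_pi_norm v i) 2
    _ = d * ‖v‖ ^ 2 := by simp
    _ ≤ (d * ‖v‖) ^ 2 := by
        rw [mul_pow]
        gcongr
        exact_mod_cast Nat.le_self_pow two_ne_zero d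

lemma mnorm_le_mul_norm {d : ℕ} (A : Mat d) : mnorm A ≤ d * ‖A‖ := by
  refine Real.sqrt_le_iff.2 ⟨by positivity, ?_⟩
  calc ∑ i, ∑ j, A i j ^ 2 ≤ ∑ _i : Fin d, ∑ _j : Fin d, ‖A‖ ^ 2 :=
        Finset.sum_le_sum fun i _ => Finset.sum_le_sum fun j _ => by
        rw [← sq_abs]
        exact pow_le_pow_left₀ (abs_nonneg _) (Matrix.norm_entry_le_entrywise_sup_norm A) 2
    _ = (d * ‖A‖) ^ 2 := by
        simp
        ring

/-- A point on the lacunary moment curve. -/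
def lacunary (d : ℕ) (s : ℝ) : Vec d := fun i => s ^ 2 ^ (i : ℕ)

open Polynomial in
lemma exists_polynomial_dotProduct_lacunary {d : ℕ} (v : Vec d) :
    ∃ P : ℝ[X], P.natDegree ≤ 2 ^ (d + 1) ∧ (∀ s, P.eval s = lacunary d s ⬝ᵥ v) ∧
      (P = 0 → v = 0) := by
  refine ⟨∑ i, C (v i) * X ^ 2 ^ (i : ℕ), ?_, fun s => ?_, fun h => funext fun i => ?_⟩
  · refine natDegree_sum_le_of_forall_le _ _ fun i _ => (natDegree_C_mul_X_pow_le _ _).trans ?_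
    exact Nat.pow_le_pow_right two_pos (by omega)
  · simp only [eval_finsetSum, eval_mul, eval_C, eval_pow, eval_X, dotProduct, lacunary]
    exact Finset.sum_congr rfl fun i _ => mul_comm _ _
  · have h1 := congrArg (coeff · (2 ^ (i : ℕ))) h
    simp only [finsetSum_coeff, coeff_C_mul, coeff_X_pow, coeff_zero] at h1
    rw [Finset.sum_eq_single i] at h1
    · simpa using h1
    · intro j _ hj
      rw [if_neg, mul_zero]
      intro h2
      exact hj (Fin.ext (Nat.pow_right_injective le_rfl h2).symm)
    · simp

lemma two_pow_add_two_pow {i j a b : ℕ} (h : 2 ^ i + 2 ^ j = 2 ^ a + 2 ^ b) :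
    (i = a ∧ j = b) ∨ (i = b ∧ j = a) := by
  have key : ∀ {i j a b : ℕ}, i ≤ j → a ≤ b → 2 ^ i + 2 ^ j = 2 ^ a + 2 ^ b → i = a ∧ j = b := by
    have hinj : ∀ {x y : ℕ}, 2 ^ x = 2 ^ y → x = y := fun h => Nat.pow_right_injective le_rfl h
    intro i
    induction i with
    | zero =>
      intro j a b hij hab h
      rcases a with _ | a
      · exact ⟨rfl, hinj (by omega)⟩
      · obtain ⟨b, rfl⟩ : ∃ c, b = c + 1 := ⟨b - 1, by omega⟩
        have := Nat.one_le_two_pow (n := a)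
        have := Nat.one_le_two_pow (n := b)
        rcases j with _ | j <;> simp only [pow_succ, pow_zero] at h <;> omega
    | succ i ih =>
      intro j a b hij hab h
      obtain ⟨j, rfl⟩ : ∃ c, j = c + 1 := ⟨j - 1, by omega⟩
      have := Nat.one_le_two_pow (n := i)
      have := Nat.one_le_two_pow (n := j)
      rcases a with _ | a
      · rcases b with _ | b <;> simp only [pow_succ, pow_zero] at h <;> omega
      · obtain ⟨b, rfl⟩ : ∃ c, b = c + 1 := ⟨b - 1, by omega⟩
        simp only [pow_succ] at h
        have := ih (j := j) (a := a) (b := b) (by omega) (by omega) (by omega)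
        omega
  rcases le_total i j with h1 | h1 <;> rcases le_total a b with h2 | h2
  · exact Or.inl (key h1 h2 h)
  · exact Or.inr (key h1 h2 (h.trans (add_comm _ _)))
  · exact Or.inr (key h1 h2 ((add_comm _ _).trans h)).symm
  · exact Or.inl (key h1 h2 (by omega)).symm

open Polynomial in
lemma exists_polynomial_quadratic_lacunary {d : ℕ} (S : Mat d) (hS : Sᵀ = S) :
    ∃ P : ℝ[X], P.natDegree ≤ 2 ^ (d + 1) ∧
      (∀ s, P.eval s = lacunary d s ⬝ᵥ (S *ᵥ lacunary d s)) ∧ (P = 0 → S = 0) := by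
  refine ⟨∑ i, ∑ j, C (S i j) * X ^ (2 ^ (i : ℕ) + 2 ^ (j : ℕ)), ?_, fun s => ?_,
    fun h => Matrix.ext fun a b => ?_⟩
  · refine natDegree_sum_le_of_forall_le _ _ fun i _ => natDegree_sum_le_of_forall_le _ _
      fun j _ => (natDegree_C_mul_X_pow_le _ _).trans ?_
    have h1 := Nat.pow_le_pow_right two_pos i.2.le
    have h2 := Nat.pow_le_pow_right two_pos j.2.le
    rw [pow_succ]
    omega
  · simp only [eval_finsetSum, eval_mul, eval_C, eval_pow, eval_X, dotProduct, mulVec, lacunary,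
      Finset.mul_sum]
    exact Finset.sum_congr rfl fun i _ => Finset.sum_congr rfl fun j _ => by ring
  · have h1 := congrArg (coeff · (2 ^ (a : ℕ) + 2 ^ (b : ℕ))) h
    simp only [finsetSum_coeff, coeff_C_mul, coeff_X_pow, coeff_zero] at h1
    have h2 : ∀ i j : Fin d, S i j * (if 2 ^ (a : ℕ) + 2 ^ (b : ℕ) = 2 ^ (i : ℕ) + 2 ^ (j : ℕ)
        then 1 else 0) = S a b * (if 2 ^ (a : ℕ) + 2 ^ (b : ℕ) = 2 ^ (i : ℕ) + 2 ^ (j : ℕ)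
        then 1 else 0) := by
      intro i j
      split_ifs with hij
      · rcases two_pow_add_two_pow hij with ⟨h3, h4⟩ | ⟨h3, h4⟩
        · rw [Fin.ext h3, Fin.ext h4]
        · rw [Fin.ext h3, Fin.ext h4, ← Matrix.transpose_apply S, hS]
      · simp
    simp only [h2, ← Finset.mul_sum] at h1
    refine (mul_eq_zero.1 h1).resolve_right (ne_of_gt ?_)
    refine Finset.sum_pos' (fun i _ => Finset.sum_nonneg fun j _ => by split_ifs <;> simp)
      ⟨a, Finset.mem_univ _, Finset.sum_pos' (fun j _ => by split_ifs <;> simp)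
        ⟨b, Finset.mem_univ _, by simp⟩⟩

/-- Finitely many directions which separate given parameters and jointly control all parameters. -/
lemma exists_directions {d k₀ : ℕ} (x : Fin k₀ → Vec d × Mat d) (hx : Function.Injective x)
    (hsymm : ∀ i, (x i).2ᵀ = (x i).2) :
    ∃ U : Finset (Vec d), U.Nonempty ∧
      (∀ u ∈ U, Function.Injective fun i => (u ⬝ᵥ ((x i).2 *ᵥ u) / 2, u ⬝ᵥ (x i).1)) ∧
      ∃ C > 0, ∀ p q : Vec d × Mat d, p.2ᵀ = p.2 → q.2ᵀ = q.2 →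
        parDist p q ≤ C * ∑ u ∈ U, (|u ⬝ᵥ p.1 - u ⬝ᵥ q.1| +
          |u ⬝ᵥ (p.2 *ᵥ u) / 2 - u ⬝ᵥ (q.2 *ᵥ u) / 2|) := by
  classical
  have hfin : ∀ ij : Fin k₀ × Fin k₀, {s : ℝ | ij.1 ≠ ij.2 ∧
      lacunary d s ⬝ᵥ ((x ij.1).2 *ᵥ lacunary d s) / 2 =
        lacunary d s ⬝ᵥ ((x ij.2).2 *ᵥ lacunary d s) / 2 ∧
      lacunary d s ⬝ᵥ (x ij.1).1 = lacunary d s ⬝ᵥ (x ij.2).1}.Finite := by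
    rintro ⟨i, j⟩
    by_cases hij : i = j
    · simp [hij]
    obtain ⟨P, -, hP, hP0⟩ := exists_polynomial_dotProduct_lacunary ((x i).1 - (x j).1)
    obtain ⟨Q, -, hQ, hQ0⟩ := exists_polynomial_quadratic_lacunary ((x i).2 - (x j).2)
      (by simp [hsymm])
    by_cases hne : P = 0
    · have hQne : Q ≠ 0 := fun h => hij (hx (Prod.ext (sub_eq_zero.1 (hP0 hne))
        (sub_eq_zero.1 (hQ0 h))))
      refine (Q.finite_setOfPred_isRoot hQne).subset fun s hs => ?_
      change Q.eval s = 0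
      rw [hQ, Matrix.sub_mulVec, dotProduct_sub]
      linarith [hs.2.1]
    · refine (P.finite_setOfPred_isRoot hne).subset fun s hs => ?_
      change P.eval s = 0
      rw [hP, dotProduct_sub, hs.2.2, sub_self]
  have hinf := (Set.finite_iUnion hfin).infinite_compl
  obtain ⟨T, hT, hTcard⟩ := hinf.exists_subset_card_eq (2 ^ (d + 1) + 1)
  refine ⟨T.image (lacunary d), (Finset.card_pos.1 (by omega)).image _, ?_, ?_⟩
  · simp only [Finset.mem_image, forall_exists_index, and_imp, forall_apply_eq_imp_iff₂]
    intro s hs i j hij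
    by_contra hne
    refine hT hs (Set.mem_iUnion.2 ⟨(i, j), hne, ?_⟩)
    exact ⟨(Prod.mk.inj hij).1, (Prod.mk.inj hij).2⟩
  set U := T.image (lacunary d) with hU
  let L : Vec d × Mat d →ₗ[ℝ] (U → ℝ) × (U → ℝ) × Mat d :=
    { toFun := fun p => (fun u => u.1 ⬝ᵥ p.1, fun u => u.1 ⬝ᵥ (p.2 *ᵥ u.1) / 2, p.2 - p.2ᵀ)
      map_add' := fun p q => by
        refine Prod.ext (funext fun u => ?_) (Prod.ext (funext fun u => ?_) ?_)
        · simp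
        · simp [Matrix.add_mulVec, add_div]
        · simp
          abel
      map_smul' := fun c p => by
        refine Prod.ext (funext fun u => ?_) (Prod.ext (funext fun u => ?_) ?_)
        · simp
        · simp [Matrix.smul_mulVec, mul_div_assoc]
        · simp [smul_sub] }
  have hker : LinearMap.ker L = ⊥ := by
    rw [LinearMap.ker_eq_bot']
    rintro ⟨v, S⟩ h0
    obtain ⟨h1, h2⟩ := Prod.mk.inj h0
    obtain ⟨h2, h3⟩ := Prod.mk.inj h2
    obtain ⟨P, hPd, hP, hP0⟩ := exists_polynomial_dotProduct_lacunary v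
    obtain ⟨Q, hQd, hQ, hQ0⟩ := exists_polynomial_quadratic_lacunary S (sub_eq_zero.1 h3).symm
    have hmem : ∀ s ∈ T, lacunary d s ∈ U := fun s hs => Finset.mem_image_of_mem _ hs
    refine Prod.ext (hP0 ?_) (hQ0 ?_)
    · refine Polynomial.eq_zero_of_natDegree_lt_card_of_eval_eq_zero' P T (fun s hs => ?_)
        (by omega)
      rw [hP]
      exact congrFun h1 ⟨_, hmem s hs⟩
    · refine Polynomial.eq_zero_of_natDegree_lt_card_of_eval_eq_zero' Q T (fun s hs => ?_)
        (by omega)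
      rw [hQ]
      have := congrFun h2 ⟨_, hmem s hs⟩
      simp only [Pi.zero_apply] at this
      linarith
  obtain ⟨C, hC, hL⟩ := L.exists_antilipschitzWith hker
  refine ⟨2 * d * C + 1, by positivity, fun p q hp hq => ?_⟩
  set Z := ∑ u ∈ U, (|u ⬝ᵥ p.1 - u ⬝ᵥ q.1| +
          |u ⬝ᵥ (p.2 *ᵥ u) / 2 - u ⬝ᵥ (q.2 *ᵥ u) / 2|) with hZ
  have hZ0 : 0 ≤ Z := by positivity
  have hle : ∀ u ∈ U, |u ⬝ᵥ p.1 - u ⬝ᵥ q.1| + |u ⬝ᵥ (p.2 *ᵥ u) / 2 - u ⬝ᵥ (q.2 *ᵥ u) / 2| ≤ Z :=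
    fun u hu => Finset.single_le_sum (f := fun u => |u ⬝ᵥ p.1 - u ⬝ᵥ q.1| +
      |u ⬝ᵥ (p.2 *ᵥ u) / 2 - u ⬝ᵥ (q.2 *ᵥ u) / 2|) (fun _ _ => by positivity) hu
  have h1 : ‖L (p - q)‖ ≤ Z := by
    refine norm_prod_le_iff.2 ⟨(pi_norm_le_iff_of_nonneg hZ0).2 fun u => ?_,
      norm_prod_le_iff.2 ⟨(pi_norm_le_iff_of_nonneg hZ0).2 fun u => ?_, ?_⟩⟩
    · have h2 := hle u.1 u.2
      have h3 := abs_nonneg (u.1 ⬝ᵥ (p.2 *ᵥ u.1) / 2 - u.1 ⬝ᵥ (q.2 *ᵥ u.1) / 2)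
      simp only [L, LinearMap.coe_mk, AddHom.coe_mk, Prod.fst_sub, dotProduct_sub,
        Real.norm_eq_abs]
      linarith
    · have h2 := hle u.1 u.2
      have h3 := abs_nonneg (u.1 ⬝ᵥ p.1 - u.1 ⬝ᵥ q.1)
      simp only [L, LinearMap.coe_mk, AddHom.coe_mk, Prod.snd_sub, dotProduct_sub, sub_div,
        Matrix.sub_mulVec, Real.norm_eq_abs]
      linarith
    · simpa [L, hp, hq] using hZ0
  have h2 : ‖p - q‖ ≤ C * Z := by
    have := hL.le_mul_dist p q
    rw [dist_eq_norm, dist_eq_norm, ← map_sub] at this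
    exact this.trans (by gcongr)
  have h3 := (vnorm_le_mul_norm (p.1 - q.1)).trans
    (mul_le_mul_of_nonneg_left (norm_fst_le (p - q)) d.cast_nonneg)
  have h4 := (mnorm_le_mul_norm (p.2 - q.2)).trans
    (mul_le_mul_of_nonneg_left (norm_snd_le (p - q)) d.cast_nonneg)
  have h5 : (d : ℝ) * ‖p - q‖ ≤ d * (C * Z) := by gcongr
  rw [parDist]
  linarith

lemma abs_dotProduct_le {d : ℕ} (u v : Vec d) : |u ⬝ᵥ v| ≤ (∑ i, |u i|) * vnorm v := by
  rw [dotProduct, Finset.sum_mul]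
  refine (Finset.abs_sum_le_sum_abs _ _).trans (Finset.sum_le_sum fun i _ => ?_)
  rw [abs_mul]
  exact mul_le_mul_of_nonneg_left (abs_apply_le_vnorm v i) (abs_nonneg _)

lemma abs_quadratic_le {d : ℕ} (u : Vec d) (A : Mat d) :
    |u ⬝ᵥ (A *ᵥ u)| ≤ (∑ i, |u i|) ^ 2 * mnorm A := by
  rw [dotProduct, sq, mul_assoc, Finset.sum_mul]
  refine (Finset.abs_sum_le_sum_abs _ _).trans (Finset.sum_le_sum fun i _ => ?_)
  rw [abs_mul]
  refine mul_le_mul_of_nonneg_left ?_ (abs_nonneg _)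
  rw [mulVec, dotProduct, Finset.sum_mul]
  refine (Finset.abs_sum_le_sum_abs _ _).trans (Finset.sum_le_sum fun j _ => ?_)
  rw [abs_mul, mul_comm]
  exact mul_le_mul_of_nonneg_left (abs_apply_le_mnorm A i j) (abs_nonneg _)

lemma sum_add_pow_le {ι : Type*} (s : Finset ι) {x y : ι → ℝ} (hx : ∀ i, 0 ≤ x i)
    (hy : ∀ i, 0 ≤ y i) {r : ℕ} {Y : ℝ} (hr : r ≠ 0) (h : ∀ i ∈ s, x i ^ r + y i ^ r ≤ Y) :
    (∑ i ∈ s, (x i + y i)) ^ r ≤ (2 * s.card) ^ r * Y := by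
  rcases s.eq_empty_or_nonempty with rfl | ⟨i₀, hi₀⟩
  · simp [hr]
  have hY : 0 ≤ Y := le_trans (by have := hx i₀; have := hy i₀; positivity) (h i₀ hi₀)
  have hle : ∀ t : ℝ, 0 ≤ t → t ^ r ≤ Y → t ≤ Y ^ ((r : ℝ)⁻¹) := fun t ht h => by
    rw [← Real.pow_rpow_inv_natCast ht hr]
    exact Real.rpow_le_rpow (by positivity) h (by positivity)
  have h1 : ∑ i ∈ s, (x i + y i) ≤ 2 * s.card * Y ^ ((r : ℝ)⁻¹) := by
    calc ∑ i ∈ s, (x i + y i) ≤ ∑ _i ∈ s, 2 * Y ^ ((r : ℝ)⁻¹) := by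
          refine Finset.sum_le_sum fun i hi => ?_
          have h2 := hle (x i) (hx i) (by linarith [h i hi, pow_nonneg (hy i) r])
          have h3 := hle (y i) (hy i) (by linarith [h i hi, pow_nonneg (hx i) r])
          linarith
      _ = _ := by
          simp only [Finset.sum_const, nsmul_eq_mul]
          ring
  calc _ ≤ (2 * s.card * Y ^ ((r : ℝ)⁻¹)) ^ r :=
        pow_le_pow_left₀ (Finset.sum_nonneg fun i _ => add_nonneg (hx i) (hy i)) h1 r
    _ = _ := by rw [mul_pow, Real.rpow_inv_natCast_pow hY hr]

lemma Mix.w_le_one {P : Type*} {k : ℕ} (G : Mix P k) (i : Fin k) : G.w i ≤ 1 :=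
  G.w_sum ▸ Finset.single_le_sum (fun i _ => (G.w_pos i).le) (Finset.mem_univ i)

lemma Matrix.PosDef.transpose_eq {d : ℕ} {M : Mat d} (hM : M.PosDef) : Mᵀ = M := by
  simpa using hM.isHermitian.eq

/-- Inverse bound for mixtures whose atoms are close to prescribed atoms of the true mixture. -/
lemma exists_assignment_bound {d k₀ K m r : ℕ} (G₀ : Mix (Vec d × Mat d) k₀)
    (hG₀ : ∀ i, (G₀.atom i).2.PosDef) (σ : Fin K → Fin k₀)
    (hcard : ∀ i, (Finset.univ.filter fun j => σ j = i).card ≤ m)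
    (h : ¬ NontrivSol m r) (hr : 4 ≤ r) {c₀ : ℝ} (hc₀ : 0 < c₀) :
    ∃ δ > 0, ∃ C > 0, ∀ G : Mix (Vec d × Mat d) K, (∀ j, (G.atom j).2.PosDef) →
      (∀ j, c₀ ≤ G.w j) → (∀ j, parDist (G.atom j) (G₀.atom (σ j)) ≤ δ) →
      (∀ i, |∑ j with σ j = i, G.w j - G₀.w i| ≤
        C * TV Set.univ (Mix.density (gaussFam d) G) (Mix.density (gaussFam d) G₀)) ∧
      ∀ j, parDist (G.atom j) (G₀.atom (σ j)) ^ r ≤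
        C * TV Set.univ (Mix.density (gaussFam d) G) (Mix.density (gaussFam d) G₀) := by
  obtain ⟨U, hU, hUinj, B, hB, hUB⟩ := exists_directions G₀.atom G₀.atom_inj
    fun i => (hG₀ i).transpose_eq
  have hmain := fun u (hu : u ∈ U) => exists_one_dim_bound
    (a₀ := fun i => u ⬝ᵥ (G₀.atom i).1) (b₀ := fun i => u ⬝ᵥ ((G₀.atom i).2 *ᵥ u) / 2)
    (hUinj u hu) (fun i => div_nonneg
      (by simpa using (hG₀ i).posSemidef.dotProduct_mulVec_nonneg u) zero_le_two) σ hcard h hr hc₀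
  choose! δ hδ C hC hmain using hmain
  set M : Vec d → ℝ := fun u => (∑ i, |u i| + 1) ^ 2 with hM
  have hMpos : ∀ u, 0 < M u := fun u => by positivity
  set A : ℝ := ∑ u ∈ U, 2 * C u with hA
  have hApos : 0 < A := Finset.sum_pos (fun u hu => mul_pos two_pos (hC u hu)) hU
  have hAle : ∀ u ∈ U, C u * 2 ≤ A := fun u hu => by
    rw [mul_comm]
    exact Finset.single_le_sum (f := fun u => 2 * C u)
      (fun u hu => (mul_pos two_pos (hC u hu)).le) hu
  refine ⟨U.inf' hU fun u => δ u / M u,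
    (Finset.lt_inf'_iff hU).2 fun u hu => div_pos (hδ u hu) (hMpos u),
    A + B ^ r * ((2 * U.card) ^ r * A), by positivity, fun G hG hw hclose => ?_⟩
  set T := TV Set.univ (Mix.density (gaussFam d) G) (Mix.density (gaussFam d) G₀) with hT
  have hT0 : 0 ≤ T := mul_nonneg (by norm_num) (integral_nonneg fun x => abs_nonneg _)
  have hconc : ∀ u ∈ U, (∀ i, |∑ j with σ j = i, G.w j - G₀.w i| ≤ C u * (2 * T)) ∧
      ∀ j, |u ⬝ᵥ (G.atom j).1 - u ⬝ᵥ (G₀.atom (σ j)).1| ^ r +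
        |u ⬝ᵥ ((G.atom j).2 *ᵥ u) / 2 - u ⬝ᵥ ((G₀.atom (σ j)).2 *ᵥ u) / 2| ^ r ≤
        C u * (2 * T) := by
    intro u hu
    have hd : ∀ j, M u * parDist (G.atom j) (G₀.atom (σ j)) ≤ δ u := fun j => by
      rw [← le_div_iff₀' (hMpos u)]
      exact (hclose j).trans (Finset.inf'_le _ hu)
    have hS : 0 ≤ ∑ i, |u i| := by positivity
    refine hmain u hu G.w _ _ G₀.w _ (fun j => ⟨hw j, G.w_le_one j⟩) (fun j => ?_) (fun j => ?_)
      fun s _ => norm_sub_le_two_mul_TV G G₀ hG hG₀ u s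
    · rw [← dotProduct_sub]
      refine ((abs_dotProduct_le _ _).trans ?_).trans (hd j)
      refine mul_le_mul ?_ (le_add_of_nonneg_right (Real.sqrt_nonneg _)) (Real.sqrt_nonneg _)
        (hMpos u).le
      simp only [hM]
      nlinarith
    · rw [← sub_div, ← dotProduct_sub, ← Matrix.sub_mulVec, abs_div, abs_two]
      refine ((half_le_self (abs_nonneg _)).trans ((abs_quadratic_le _ _).trans ?_)).trans (hd j)
      refine mul_le_mul ?_ (le_add_of_nonneg_left (Real.sqrt_nonneg _)) (Real.sqrt_nonneg _)
        (hMpos u).le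
      simp only [hM]
      nlinarith
  have hle : ∀ u ∈ U, C u * (2 * T) ≤ A * T := fun u hu => by
    rw [← mul_assoc]
    exact mul_le_mul_of_nonneg_right (hAle u hu) hT0
  have hX : 0 ≤ B ^ r * ((2 * U.card) ^ r * A) * T := by positivity
  refine ⟨fun i => ?_, fun j => ?_⟩
  · obtain ⟨u, hu⟩ := hU
    have := ((hconc u hu).1 i).trans (hle u hu)
    linarith
  · have h1 := sum_add_pow_le U (fun u => abs_nonneg (u ⬝ᵥ (G.atom j).1 - u ⬝ᵥ (G₀.atom (σ j)).1))
      (fun u => abs_nonneg (u ⬝ᵥ ((G.atom j).2 *ᵥ u) / 2 - u ⬝ᵥ ((G₀.atom (σ j)).2 *ᵥ u) / 2))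
      (by omega) fun u hu => ((hconc u hu).2 j).trans (hle u hu)
    have h2 := pow_le_pow_left₀ (parDist_nonneg _ _)
      (hUB (G.atom j) (G₀.atom (σ j)) (hG j).transpose_eq (hG₀ (σ j)).transpose_eq) r
    rw [mul_pow] at h2
    have h3 := mul_le_mul_of_nonneg_left h1 (pow_nonneg hB.le r)
    have h4 : 0 ≤ A * T := by positivity
    linarith

/-- A coupling which moves little mass away from a prescribed assignment. -/
lemma exists_coupling {K k₀ : ℕ} {w : Fin K → ℝ} {p : Fin k₀ → ℝ} (hw : ∀ j, 0 < w j)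
    (hp : ∀ i, 0 ≤ p i) (hsum : ∑ j, w j = ∑ i, p i) {σ : Fin K → Fin k₀}
    (hσ : Function.Surjective σ) :
    ∃ q : Fin K → Fin k₀ → ℝ, (∀ j i, 0 ≤ q j i) ∧ (∀ j, ∑ i, q j i = w j) ∧
      (∀ i, ∑ j, q j i = p i) ∧
      ∀ j i, i ≠ σ j → q j i ≤ |∑ j' with σ j' = σ j, w j' - p (σ j)| := by
  set π : Fin k₀ → ℝ := fun i => ∑ j with σ j = i, w j with hπ
  have hwπ : ∀ j, w j ≤ π (σ j) := fun j =>
    Finset.single_le_sum (f := w) (fun j _ => (hw j).le) (by simp)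
  have hπpos : ∀ i, 0 < π i := fun i => by
    obtain ⟨j, rfl⟩ := hσ i
    exact (hw j).trans_le (hwπ j)
  have hπsum : ∑ i, π i = ∑ i, p i := by rw [← hsum, hπ, Finset.sum_fiberwise]
  set T : ℝ := ∑ i, max (p i - π i) 0 with hT
  have hT' : ∑ i, max (π i - p i) 0 = T := by
    rw [hT, ← sub_eq_zero, ← Finset.sum_sub_distrib]
    have : ∀ i, max (π i - p i) 0 - max (p i - π i) 0 = π i - p i := fun i => by
      rcases le_total (π i) (p i) with h | h
      · rw [max_eq_right (by linarith), max_eq_left (by linarith)]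
        ring
      · rw [max_eq_left (by linarith), max_eq_right (by linarith)]
        ring
    simp [this, hπsum]
  have hT0 : 0 ≤ T := Finset.sum_nonneg fun i _ => le_max_right _ _
  have hcancel : ∀ x, 0 ≤ x → x ≤ T → x * (T / T) = x := fun x h0 hx => by
    rcases hT0.eq_or_lt with h | h
    · rw [le_antisymm (hx.trans h.ge) h0, zero_mul]
    · rw [div_self h.ne', mul_one]
  have hmin : ∀ i, min (π i) (p i) + max (π i - p i) 0 = π i := fun i => by
    rcases le_total (π i) (p i) with h | h
    · rw [min_eq_left h, max_eq_right (by linarith), add_zero]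
    · rw [min_eq_right h, max_eq_left (by linarith)]
      ring
  have hmin' : ∀ i, min (π i) (p i) + max (p i - π i) 0 = p i := fun i => by
    rcases le_total (π i) (p i) with h | h
    · rw [min_eq_left h, max_eq_left (by linarith)]
      ring
    · rw [min_eq_right h, max_eq_right (by linarith), add_zero]
  have hle1 : ∀ i, max (p i - π i) 0 ≤ T := fun i =>
    Finset.single_le_sum (f := fun i => max (p i - π i) 0) (fun _ _ => le_max_right _ _)
      (Finset.mem_univ i)
  have hle2 : ∀ i, max (π i - p i) 0 ≤ T := fun i => hT' ▸
    Finset.single_le_sum (f := fun i => max (π i - p i) 0) (fun _ _ => le_max_right _ _)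
      (Finset.mem_univ i)
  set κ : Fin k₀ → Fin k₀ → ℝ := fun l i =>
    (if i = l then min (π l) (p l) else 0) + max (π l - p l) 0 * (max (p i - π i) 0 / T) with hκ
  have hκ0 : ∀ l i, 0 ≤ κ l i := fun l i => by
    have h1 := le_min (hπpos l).le (hp l)
    have h2 : 0 ≤ max (π l - p l) 0 * (max (p i - π i) 0 / T) :=
      mul_nonneg (le_max_right _ _) (div_nonneg (le_max_right _ _) hT0)
    simp only [hκ]
    split_ifs <;> linarith
  have hrow : ∀ l, ∑ i, κ l i = π l := fun l => by
    simp only [hκ, Finset.sum_add_distrib, ← Finset.mul_sum, ← Finset.sum_div]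
    rw [Finset.sum_ite_eq' Finset.univ l, if_pos (Finset.mem_univ _), ← hT,
      hcancel _ (le_max_right _ _) (hle2 l), hmin]
  have hcol : ∀ i, ∑ l, κ l i = p i := fun i => by
    simp only [hκ, Finset.sum_add_distrib, ← Finset.sum_mul]
    rw [Finset.sum_ite_eq Finset.univ i, if_pos (Finset.mem_univ _), hT', mul_div_left_comm,
      hcancel _ (le_max_right _ _) (hle1 i), hmin']
  refine ⟨fun j i => w j * (κ (σ j) i / π (σ j)), fun j i =>
    mul_nonneg (hw j).le (div_nonneg (hκ0 _ _) (hπpos _).le), fun j => ?_, fun i => ?_,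
    fun j i hij => ?_⟩
  · rw [← Finset.mul_sum, ← Finset.sum_div, hrow, div_self (hπpos _).ne', mul_one]
  · rw [← Finset.sum_fiberwise Finset.univ σ, ← hcol i]
    refine Finset.sum_congr rfl fun l _ => ?_
    calc ∑ j with σ j = l, w j * (κ (σ j) i / π (σ j))
        = ∑ j with σ j = l, w j * (κ l i / π l) :=
          Finset.sum_congr rfl fun j hj => by rw [(Finset.mem_filter.1 hj).2]
      _ = π l * (κ l i / π l) := by rw [← Finset.sum_mul]
      _ = κ l i := mul_div_cancel₀ _ (hπpos l).ne'
  · have h1 : κ (σ j) i ≤ |π (σ j) - p (σ j)| := by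
      simp only [hκ, if_neg hij, zero_add]
      refine (mul_le_of_le_one_right (le_max_right _ _) (div_le_one_of_le₀ (hle1 i) hT0)).trans ?_
      exact max_le (le_abs_self _) (abs_nonneg _)
    calc w j * (κ (σ j) i / π (σ j)) ≤ π (σ j) * (κ (σ j) i / π (σ j)) :=
          mul_le_mul_of_nonneg_right (hwπ j) (div_nonneg (hκ0 _ _) (hπpos _).le)
      _ = κ (σ j) i := mul_div_cancel₀ _ (hπpos _).ne'
      _ ≤ _ := h1

section Transport

variable {P : Type*} {ρ : P → P → ℝ} {k k' : ℕ}

lemma wrPow_bddBelow (hρ : ∀ x y, 0 ≤ ρ x y) (r : ℝ) (G : Mix P k) (G' : Mix P k') :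
    (0 : ℝ) ∈ lowerBounds { c : ℝ | ∃ q : Fin k → Fin k' → ℝ,
      (∀ i j, 0 ≤ q i j) ∧ (∀ i, ∑ j, q i j = G.w i) ∧ (∀ j, ∑ i, q i j = G'.w j) ∧
      c = ∑ i, ∑ j, q i j * ρ (G.atom i) (G'.atom j) ^ r } := by
  rintro c ⟨q, hq, -, -, rfl⟩
  exact Finset.sum_nonneg fun i _ => Finset.sum_nonneg fun j _ =>
    mul_nonneg (hq i j) (Real.rpow_nonneg (hρ _ _) _)

lemma wrPow_nonempty (r : ℝ) (G : Mix P k) (G' : Mix P k') :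
    { c : ℝ | ∃ q : Fin k → Fin k' → ℝ,
      (∀ i j, 0 ≤ q i j) ∧ (∀ i, ∑ j, q i j = G.w i) ∧ (∀ j, ∑ i, q i j = G'.w j) ∧
      c = ∑ i, ∑ j, q i j * ρ (G.atom i) (G'.atom j) ^ r }.Nonempty :=
  ⟨_, fun i j => G.w i * G'.w j, fun i j => mul_nonneg (G.w_pos i).le (G'.w_pos j).le,
    fun i => by rw [← Finset.mul_sum, G'.w_sum, mul_one],
    fun j => by rw [← Finset.sum_mul, G.w_sum, one_mul], rfl⟩

lemma wrPow_nonneg (hρ : ∀ x y, 0 ≤ ρ x y) (r : ℝ) (G : Mix P k) (G' : Mix P k') :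
    0 ≤ WrPow ρ r G G' :=
  le_csInf (wrPow_nonempty r G G') (wrPow_bddBelow hρ r G G')

lemma wr_pow (hρ : ∀ x y, 0 ≤ ρ x y) {r : ℕ} (hr : r ≠ 0) (G : Mix P k) (G' : Mix P k') :
    Wr ρ r G G' ^ r = WrPow ρ r G G' := by
  rw [Wr, one_div, Real.rpow_inv_natCast_pow (wrPow_nonneg hρ _ _ _) hr]

lemma wr_one_pow_le (hρ : ∀ x y, 0 ≤ ρ x y) {r : ℕ} (G : Mix P k) (G' : Mix P k') :
    Wr ρ 1 G G' ^ r ≤ WrPow ρ r G G' := by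
  refine le_csInf (wrPow_nonempty _ G G') ?_
  rintro c ⟨q, hq, hq1, hq2, rfl⟩
  have h1 : Wr ρ 1 G G' ≤ ∑ x : Fin k × Fin k', q x.1 x.2 * ρ (G.atom x.1) (G'.atom x.2) := by
    rw [Wr, div_one, Real.rpow_one, Fintype.sum_prod_type]
    exact csInf_le ⟨0, wrPow_bddBelow hρ 1 G G'⟩ ⟨q, hq, hq1, hq2, by simp⟩
  have h0 : 0 ≤ Wr ρ 1 G G' := Real.rpow_nonneg (wrPow_nonneg hρ _ _ _) _
  refine (pow_le_pow_left₀ h0 h1 r).trans ((Real.pow_arith_mean_le_arith_mean_pow _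
    (fun x : Fin k × Fin k' => q x.1 x.2) _ (fun x _ => hq _ _) ?_ (fun x _ => hρ _ _) r).trans ?_)
  · simp [Fintype.sum_prod_type, hq1, G.w_sum]
  · simp [Fintype.sum_prod_type]

lemma wrPow_le_of_assignment (hρ : ∀ x y, 0 ≤ ρ x y) {r : ℕ} (G : Mix P k) (G' : Mix P k')
    {σ : Fin k → Fin k'} (hσ : Function.Surjective σ) {B Y : ℝ}
    (hB : ∀ j i, ρ (G.atom j) (G'.atom i) ≤ B) (hB0 : 0 ≤ B)
    (h1 : ∀ i, |∑ j with σ j = i, G.w j - G'.w i| ≤ Y)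
    (h2 : ∀ j, ρ (G.atom j) (G'.atom (σ j)) ^ r ≤ Y) :
    WrPow ρ r G G' ≤ k * k' * ((1 + B ^ r) * Y) := by
  obtain ⟨q, hq, hq1, hq2, hq3⟩ := exists_coupling G.w_pos (fun i => (G'.w_pos i).le)
    (G.w_sum.trans G'.w_sum.symm) hσ
  refine (csInf_le ⟨0, wrPow_bddBelow hρ r G G'⟩ ⟨q, hq, hq1, hq2, rfl⟩).trans ?_
  calc _ ≤ ∑ _j : Fin k, ∑ _i : Fin k', (1 + B ^ r) * Y := by
        refine Finset.sum_le_sum fun j _ => Finset.sum_le_sum fun i _ => ?_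
        have hY : 0 ≤ Y := (abs_nonneg _).trans (h1 i)
        have hBY : 0 ≤ B ^ r * Y := by positivity
        rw [Real.rpow_natCast]
        by_cases hij : i = σ j
        · subst hij
          have h3 : q j (σ j) ≤ 1 := ((hq1 j) ▸ Finset.single_le_sum (f := q j)
            (fun i _ => hq j i) (Finset.mem_univ (σ j))).trans (G.w_le_one j)
          have := mul_le_of_le_one_left (pow_nonneg (hρ (G.atom j) (G'.atom (σ j))) r) h3
          linarith [h2 j]
        · have := mul_le_mul ((hq3 j i hij).trans (h1 _))
            (pow_le_pow_left₀ (hρ _ _) (hB j i) r) (pow_nonneg (hρ _ _) r) hY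
          linarith
    _ = _ := by simp [mul_assoc]

/-- A small transport cost yields a nearest-atom assignment. -/
lemma exists_assignment (hρ : ∀ x y, 0 ≤ ρ x y) (hcomm : ∀ x y, ρ x y = ρ y x)
    (htri : ∀ x y z, ρ x z ≤ ρ x y + ρ y z) {r : ℕ} (G : Mix P k) (G' : Mix P k')
    {τ δ : ℝ} (hδ : 0 < δ) (hsep : ∀ i i', i ≠ i' → 2 * δ ≤ ρ (G'.atom i) (G'.atom i'))
    (hG : ∀ j, k' * τ ≤ G.w j) (hG' : ∀ i, k * τ ≤ G'.w i)
    (hlt : WrPow ρ r G G' < τ * δ ^ r) :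
    ∃ σ : Fin k → Fin k', Function.Surjective σ ∧
      ∀ j, ρ (G.atom j) (G'.atom (σ j)) < δ := by
  obtain ⟨c, ⟨q, hq, hq1, hq2, rfl⟩, hc⟩ := exists_lt_of_csInf_lt (wrPow_nonempty r G G') hlt
  have hclose : ∀ j i, τ ≤ q j i → ρ (G.atom j) (G'.atom i) < δ := by
    intro j i hji
    by_contra! hge
    refine hc.not_ge (le_trans ?_ ((Finset.single_le_sum (f := fun i => q j i *
      ρ (G.atom j) (G'.atom i) ^ (r : ℝ)) (fun i _ => mul_nonneg (hq _ _)
      (Real.rpow_nonneg (hρ _ _) _)) (Finset.mem_univ i)).trans (Finset.single_le_sum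
      (f := fun j => ∑ i, q j i * ρ (G.atom j) (G'.atom i) ^ (r : ℝ)) (fun j _ =>
      Finset.sum_nonneg fun i _ => mul_nonneg (hq _ _) (Real.rpow_nonneg (hρ _ _) _))
      (Finset.mem_univ j))))
    rw [Real.rpow_natCast]
    gcongr
    exact hq j i
  have hrow : ∀ j, ∃ i, τ ≤ q j i := by
    intro j
    by_contra! h
    have hne : (Finset.univ : Finset (Fin k')).Nonempty := by
      by_contra hne
      have := G'.w_sum
      rw [Finset.not_nonempty_iff_eq_empty.1 hne] at this
      simp at this
    have h1 := Finset.sum_lt_sum_of_nonempty hne fun i _ => h i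
    rw [hq1] at h1
    simp only [Finset.sum_const, Finset.card_univ, Fintype.card_fin, nsmul_eq_mul] at h1
    exact h1.not_ge (hG j)
  have hcol : ∀ i, ∃ j, τ ≤ q j i := by
    intro i
    by_contra! h
    have hne : (Finset.univ : Finset (Fin k)).Nonempty := by
      by_contra hne
      have := G.w_sum
      rw [Finset.not_nonempty_iff_eq_empty.1 hne] at this
      simp at this
    have h1 := Finset.sum_lt_sum_of_nonempty hne fun j _ => h j
    rw [hq2] at h1
    simp only [Finset.sum_const, Finset.card_univ, Fintype.card_fin, nsmul_eq_mul] at h1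
    exact h1.not_ge (hG' i)
  choose σ hσ using hrow
  refine ⟨σ, fun i => ?_, fun j => hclose j _ (hσ j)⟩
  obtain ⟨j, hj⟩ := hcol i
  refine ⟨j, ?_⟩
  by_contra hne
  have h1 := hclose j i hj
  have h2 := hclose j _ (hσ j)
  have h3 := hsep _ _ hne
  have h4 := htri (G'.atom (σ j)) (G.atom j) (G'.atom i)
  rw [hcomm (G'.atom (σ j)) (G.atom j)] at h4
  linarith

end Transport

lemma exists_pos_forall_le {ι : Type*} [Finite ι] {f : ι → ℝ} (hf : ∀ i, 0 < f i) :
    ∃ c > 0, ∀ i, c ≤ f i := by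
  rcases isEmpty_or_nonempty ι with h | h
  · exact ⟨1, one_pos, fun i => h.elim i⟩
  · obtain ⟨i, hi⟩ := Finite.exists_min f
    exact ⟨f i, hf i, hi⟩

lemma card_fiber_le_of_surjective {K k k₀ : ℕ} {σ : Fin K → Fin k₀}
    (hσ : Function.Surjective σ) (hK : K ≤ k) (i : Fin k₀) :
    (Finset.univ.filter fun j => σ j = i).card ≤ k - k₀ + 1 := by
  have h1 : ∑ l, (Finset.univ.filter fun j => σ j = l).card = K := by
    rw [← Finset.card_eq_sum_card_fiberwise (fun _ _ => Finset.mem_coe.2 (Finset.mem_univ _))]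
    simp
  rw [← Finset.add_sum_erase _ _ (Finset.mem_univ i)] at h1
  have h2 : k₀ - 1 ≤ ∑ l ∈ Finset.univ.erase i, (Finset.univ.filter fun j => σ j = l).card := by
    calc k₀ - 1 = ∑ _l ∈ Finset.univ.erase i, 1 := by simp
      _ ≤ _ := Finset.sum_le_sum fun l _ => Finset.card_pos.2 (by
        obtain ⟨j, rfl⟩ := hσ l
        exact ⟨j, by simp⟩)
  have := i.2
  omega

/-- **Theorem 4.3(b)** (sharp inverse bound for over-fitted Gaussian mixtures with
mixing weights bounded away from zero): with `r̄ = r̄(k−k₀+1)`, for each `c₀ > 0`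
there are `ε₀, C > 0` with `V(p_G,p_{G₀}) ≥ C W_{r̄}(G,G₀)^{r̄} ≥ C W₁(G,G₀)^{r̄}`
for all `G ∈ O_{k,c₀}(Θ×Ω)` with `W_{r̄}(G,G₀) ≤ ε₀`. -/
theorem over_fitted_gaussian_inverse_bound
    {d : ℕ} (hd : 1 ≤ d) (Θ : Set (Vec d)) (Ω : Set (Mat d))
    (hΩ : ∀ M ∈ Ω, M.PosDef)
    (hΘb : ∃ R : ℝ, ∀ θ ∈ Θ, vnorm θ ≤ R)
    (hΩb : ∃ L : ℝ, ∀ M ∈ Ω, ∀ v : Vec d, v ⬝ᵥ (M *ᵥ v) ≤ L * (v ⬝ᵥ v))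
    (k₀ : ℕ) (hk₀ : 1 ≤ k₀)
    (G₀ : Mix (Vec d × Mat d) k₀) (hG₀ : ∀ i, G₀.atom i ∈ Θ ×ˢ Ω)
    (k : ℕ) (hk : k₀ + 1 ≤ k)
    (rbar : ℕ) (hrbar : IsLeast {r : ℕ | 1 ≤ r ∧ ¬ NontrivSol (k - k₀ + 1) r} rbar)
    (c₀ : ℝ) (hc₀ : 0 < c₀) :
    ∃ ε₀ > (0 : ℝ), ∃ C > (0 : ℝ),
      ∀ (k' : ℕ), k' ≤ k → ∀ G : Mix (Vec d × Mat d) k',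
        (∀ i, G.atom i ∈ Θ ×ˢ Ω) → (∀ i, c₀ ≤ G.w i) →
        Wr parDist (rbar : ℝ) G G₀ ≤ ε₀ →
        C * Wr parDist (rbar : ℝ) G G₀ ^ rbar
            ≤ TV Set.univ (Mix.density (gaussFam d) G) (Mix.density (gaussFam d) G₀) ∧
        C * Wr parDist 1 G G₀ ^ rbar
            ≤ TV Set.univ (Mix.density (gaussFam d) G) (Mix.density (gaussFam d) G₀) := by
  obtain ⟨⟨hr1, hns⟩, -⟩ := hrbar
  have hr4 : 4 ≤ rbar := by
    by_contra hlt
    exact hns (nontrivSol_of_le_three (by omega) (by omega))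
  have hPD₀ : ∀ i, (G₀.atom i).2.PosDef := fun i => hΩ _ (hG₀ i).2
  have hmain : ∀ x : (K : Fin (k + 1)) × (Fin K → Fin k₀), ∃ δ > 0, ∃ C > 0,
      Function.Surjective x.2 → ∀ G : Mix (Vec d × Mat d) x.1, (∀ j, (G.atom j).2.PosDef) →
      (∀ j, c₀ ≤ G.w j) → (∀ j, parDist (G.atom j) (G₀.atom (x.2 j)) ≤ δ) →
      (∀ i, |∑ j with x.2 j = i, G.w j - G₀.w i| ≤
        C * TV Set.univ (Mix.density (gaussFam d) G) (Mix.density (gaussFam d) G₀)) ∧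
      ∀ j, parDist (G.atom j) (G₀.atom (x.2 j)) ^ rbar ≤
        C * TV Set.univ (Mix.density (gaussFam d) G) (Mix.density (gaussFam d) G₀) := by
    rintro ⟨K, σ⟩
    by_cases hσ : Function.Surjective σ
    · obtain ⟨δ, hδ, C, hC, h⟩ := exists_assignment_bound G₀ hPD₀ σ
        (card_fiber_le_of_surjective hσ (Nat.lt_succ_iff.1 K.2)) hns hr4 hc₀
      exact ⟨δ, hδ, C, hC, fun _ => h⟩
    · exact ⟨1, one_pos, 1, one_pos, fun h => absurd h hσ⟩
  choose δ hδ C hC hmain using hmain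
  obtain ⟨δ₁, hδ₁, hδ₁le⟩ := exists_pos_forall_le hδ
  obtain ⟨δ₂, hδ₂, hδ₂le⟩ := exists_pos_forall_le
    (f := fun x : {x : Fin k₀ × Fin k₀ // x.1 ≠ x.2} =>
      parDist (G₀.atom x.1.1) (G₀.atom x.1.2))
    fun x => parDist_pos (G₀.atom_inj.ne x.2)
  obtain ⟨p₀, hp₀, hp₀le⟩ := exists_pos_forall_le G₀.w_pos
  set δ₀ : ℝ := min 1 (min δ₁ (δ₂ / 2)) with hδ₀
  have hδ₀pos : 0 < δ₀ := by positivity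
  set B : ℝ := 1 + ∑ l, ∑ i, parDist (G₀.atom l) (G₀.atom i) with hB
  have hB0 : 0 ≤ B := add_nonneg zero_le_one
    (Finset.sum_nonneg fun l _ => Finset.sum_nonneg fun i _ => parDist_nonneg _ _)
  set D : ℝ := k * k₀ * (1 + B ^ rbar) * (1 + ∑ x, C x) with hD
  have hk0 : (0 : ℝ) < k := by exact_mod_cast (by omega : 0 < k)
  have hk₀0 : (0 : ℝ) < k₀ := by exact_mod_cast hk₀
  have hsumC : 0 ≤ ∑ x, C x := Finset.sum_nonneg fun x _ => (hC x).le
  have hDpos : 0 < D := by positivity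
  set τ : ℝ := min c₀ p₀ / k with hτ
  have hτpos : 0 < τ := by positivity
  have hτmul : ∀ n : ℕ, n ≤ k → n * τ ≤ min c₀ p₀ := fun n hn => by
    have : (n : ℝ) ≤ k := by exact_mod_cast hn
    calc n * τ ≤ k * τ := by gcongr
      _ = min c₀ p₀ := mul_div_cancel₀ _ hk0.ne'
  set t : ℝ := min 1 (τ * δ₀ ^ rbar / 2) with ht
  have htpos : 0 < t := by positivity
  refine ⟨t, htpos, D⁻¹, inv_pos.2 hDpos, fun K hK G hG hw hWr => ?_⟩
  have hr0 : rbar ≠ 0 := by omega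
  have hpow : Wr parDist (rbar : ℝ) G G₀ ^ rbar = WrPow parDist (rbar : ℝ) G G₀ :=
    wr_pow parDist_nonneg hr0 G G₀
  have hlt : WrPow parDist (rbar : ℝ) G G₀ < τ * δ₀ ^ rbar := by
    rw [← hpow]
    have h0 : 0 ≤ Wr parDist (rbar : ℝ) G G₀ :=
      Real.rpow_nonneg (wrPow_nonneg parDist_nonneg _ _ _) _
    have h1 : t ^ rbar ≤ t := pow_le_of_le_one htpos.le (min_le_left _ _) hr0
    have h2 : t ≤ τ * δ₀ ^ rbar / 2 := min_le_right _ _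
    have h3 : 0 < τ * δ₀ ^ rbar := by positivity
    linarith [pow_le_pow_left₀ h0 hWr rbar]
  obtain ⟨σ, hσ, hclose⟩ := exists_assignment parDist_nonneg parDist_comm parDist_triangle G G₀
    hδ₀pos (fun i i' hne => by
      have h1 := hδ₂le ⟨(i, i'), hne⟩
      have h2 : δ₀ ≤ δ₂ / 2 := (min_le_right _ _).trans (min_le_right _ _)
      simp only at h1
      linarith)
    (fun j => (hτmul k₀ (by omega)).trans ((min_le_left _ _).trans (hw j)))
    (fun i => (hτmul K hK).trans ((min_le_right _ _).trans (hp₀le i))) hlt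
  set T := TV Set.univ (Mix.density (gaussFam d) G) (Mix.density (gaussFam d) G₀) with hT
  have hT0 : 0 ≤ T := mul_nonneg (by norm_num) (integral_nonneg fun x => abs_nonneg _)
  set x : (K : Fin (k + 1)) × (Fin K → Fin k₀) := ⟨⟨K, by omega⟩, σ⟩ with hx
  obtain ⟨h1, h2⟩ := hmain x hσ G (fun j => hΩ _ (hG j).2) hw
    (fun j => (hclose j).le.trans (((min_le_right _ _).trans (min_le_left _ _)).trans (hδ₁le x)))
  have hbound : ∀ j i, parDist (G.atom j) (G₀.atom i) ≤ B := fun j i => by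
    have h3 : parDist (G₀.atom (σ j)) (G₀.atom i) ≤ ∑ l, ∑ i, parDist (G₀.atom l) (G₀.atom i) :=
      (Finset.single_le_sum (f := fun i => parDist (G₀.atom (σ j)) (G₀.atom i))
        (fun _ _ => parDist_nonneg _ _) (Finset.mem_univ i)).trans
      (Finset.single_le_sum (f := fun l => ∑ i, parDist (G₀.atom l) (G₀.atom i))
        (fun _ _ => Finset.sum_nonneg fun _ _ => parDist_nonneg _ _) (Finset.mem_univ (σ j)))
    have h4 := (hclose j).le.trans (min_le_left _ _)
    linarith [parDist_triangle (G.atom j) (G₀.atom (σ j)) (G₀.atom i)]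
  have hkey : D⁻¹ * WrPow parDist (rbar : ℝ) G G₀ ≤ T := by
    rw [inv_mul_le_iff₀ hDpos]
    refine (wrPow_le_of_assignment parDist_nonneg G G₀ hσ hbound hB0 h1 h2).trans ?_
    have hKk : (K : ℝ) ≤ k := by exact_mod_cast hK
    have hCx : C x ≤ 1 + ∑ x, C x := by
      linarith [Finset.single_le_sum (fun x _ => (hC x).le) (Finset.mem_univ x)]
    have hCx0 := hC x
    calc K * k₀ * ((1 + B ^ rbar) * (C x * T))
        ≤ k * k₀ * ((1 + B ^ rbar) * ((1 + ∑ x, C x) * T)) := by gcongr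
      _ = D * T := by rw [hD]; ring
  refine ⟨by rwa [hpow], le_trans ?_ hkey⟩
  exact mul_le_mul_of_nonneg_left (wr_one_pow_le parDist_nonneg G G₀) (inv_pos.2 hDpos).le
end
end

section
/- Exact-fitted Gamma mixtures, generic case (Theorem 5.2(a)): Let f(x|a,b) = (b^a/Γ(a)) x^{a−1} e^{−bx} for x > 0 be the Gamma density. Let Θ ⊂ (0,∞)², k₀ ≥ 2, and let G₀ = Σ_{i=1}^{k₀} p_i⁰ δ_{(a_i⁰,b_i⁰)} ∈ E_{k₀}(Θ) satisfy: a_i⁰ ≥ 1 for all i, and for every pair 1 ≤ i, j ≤ k₀ the unordered pair {|a_i⁰ − a_j⁰|, |b_i⁰ − b_j⁰|} is not equal to {1, 0}. Then there exist ε₀ > 0 and C₀ > 0 such that V(p_G, p_{G₀}) ≥ C₀ · W₁(G, G₀) for every G ∈ E_{k₀}(Θ) with W₁(G, G₀) ≤ ε₀. -/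
open MeasureTheory

noncomputable section

/-- The Euclidean distance on the two-dimensional parameter space `ℝ²`. -/
def pairDist (p q : ℝ × ℝ) : ℝ := Real.sqrt ((p.1 - q.1) ^ 2 + (p.2 - q.2) ^ 2)

/-- The total variation distance between two densities on `X ⊆ ℝ`. -/
def TVline (X : Set ℝ) (p q : ℝ → ℝ) : ℝ :=
  (1 / 2) * ∫ x in X, |p x - q x|

/-- The Gamma density with shape `a` and rate `b`. -/
def gammaDensity (a b x : ℝ) : ℝ :=
  if 0 < x then b ^ a / Real.Gamma a * x ^ (a - 1) * Real.exp (-(b * x)) else 0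

/-- The Gamma family, as a family indexed by the shape–rate pair. -/
def gammaFam : ℝ × ℝ → ℝ → ℝ := fun p x => gammaDensity p.1 p.2 x

open Filter Topology

lemma tendsto_rpow_mul_log_pow_nhdsGT_zero (n : ℕ) {d : ℝ} (hd : 0 < d) :
    Tendsto (fun s : ℝ => s ^ d * Real.log s ^ n) (𝓝[>] 0) (𝓝 0) := by
  induction n generalizing d with
  | zero =>
    have h : Tendsto (fun s : ℝ => s ^ d) (𝓝 0) (𝓝 (0 ^ d)) :=
      (Real.continuousAt_rpow_const 0 d (Or.inr hd.le)).tendsto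
    rw [Real.zero_rpow hd.ne'] at h
    simpa using h.mono_left nhdsWithin_le_nhds
  | succ n ih =>
    have h := (tendsto_log_mul_rpow_nhdsGT_zero (half_pos hd)).mul (ih (half_pos hd))
    rw [mul_zero] at h
    refine h.congr' ?_
    filter_upwards [self_mem_nhdsWithin] with s (hs : 0 < s)
    have : s ^ d = s ^ (d / 2) * s ^ (d / 2) := by rw [← Real.rpow_add hs, add_halves]
    rw [this]; ring

/-- The functions `t ↦ (b + t)^(-e) * log (b + t)^n` with `b, e > 0` are linearly independent on
the positive half-line. -/
lemma coeff_eq_zero_of_sum_rpow_log_eq_zero {J : Type*} [Fintype J] (b e : J → ℝ) (n : J → ℕ)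
    (he : ∀ j, 0 < e j)
    (hinj : Function.Injective fun j => (b j, e j, n j)) (c : J → ℝ) (hb : ∀ j, 0 < b j)
    (h : ∀ t : ℝ, 0 < t → ∑ j, c j * ((b j + t) ^ (-e j) * Real.log (b j + t) ^ n j) = 0) :
    ∀ j, c j = 0 := by
  classical
  by_contra! hne
  set S : Finset J := Finset.univ.filter fun j => c j ≠ 0 with hS
  have hSne : S.Nonempty := by obtain ⟨j, hj⟩ := hne; exact ⟨j, by simp [hS, hj]⟩
  obtain ⟨m, hmS, hm⟩ := Finset.exists_max_image S
    (fun j => (toLex (-b j, toLex (e j, n j)) : ℝ ×ₗ ℝ ×ₗ ℕ)) hSne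
  have hcm : c m ≠ 0 := by simpa [hS] using hmS
  have hord : ∀ j ∈ S, j ≠ m →
      b m < b j ∨ (b j = b m ∧ e j < e m) ∨ (b j = b m ∧ e j = e m ∧ n j < n m) := by
    intro j hj hjm
    have h1 := hm j hj
    rw [Prod.Lex.le_iff] at h1
    simp only [ofLex_toLex, neg_lt_neg_iff, neg_inj, Prod.Lex.le_iff] at h1
    rcases h1 with h1 | ⟨h1, h2 | ⟨h2, h3⟩⟩
    · exact Or.inl h1
    · exact Or.inr (Or.inl ⟨h1, h2⟩)
    · refine Or.inr (Or.inr ⟨h1, h2, lt_of_le_of_ne h3 fun h4 => hjm (hinj ?_)⟩)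
      simp [h1, h2, h4]
  have hbS : ∀ j ∈ S, b m ≤ b j := by
    intro j hj
    by_cases hjm : j = m
    · rw [hjm]
    · rcases hord j hj hjm with h1 | h1 | h1
      exacts [h1.le, h1.1.ge, h1.1.ge]
  set H : ℝ → ℝ := fun t => ∑ j ∈ S, c j * ((b j + t) ^ (-e j) * Real.log (b j + t) ^ n j) with hH
  have hH0 : ∀ t, 0 < t → H t = 0 := by
    intro t ht
    rw [← h t ht, hH]
    refine Finset.sum_subset (Finset.subset_univ _) fun j _ hj => ?_
    have : c j = 0 := by simpa [hS] using hj
    simp [this]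
  have han : AnalyticOnNhd ℝ H (Set.Ioi (-b m)) := by
    intro t ht
    refine Finset.analyticAt_fun_sum S fun j hj => ?_
    have hpos : 0 < b j + t := by have := hbS j hj; have : -b m < t := ht; linarith
    have h1 : AnalyticAt ℝ (fun t => b j + t) t := analyticAt_const.add analyticAt_id
    have h2 : AnalyticAt ℝ (fun t => (b j + t) ^ (-e j)) t := by
      refine ((h1.log hpos).mul (analyticAt_const (v := -e j))).rexp.congr ?_
      filter_upwards [h1.continuousAt.eventually_mem (Ioi_mem_nhds hpos)] with u hu
      exact (Real.rpow_def_of_pos hu _).symm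
    exact analyticAt_const.mul (h2.mul ((h1.log hpos).pow _))
  have hzero : Set.EqOn H 0 (Set.Ioi (-b m)) := by
    refine han.eqOn_zero_of_preconnected_of_eventuallyEq_zero isPreconnected_Ioi
      (z₀ := 1) ?_ ?_
    · have := hb m; simp only [Set.mem_Ioi]; linarith
    · filter_upwards [Ioi_mem_nhds (zero_lt_one (α := ℝ))] with t ht using hH0 t ht
  have hinv : Tendsto (fun s : ℝ => (Real.log s)⁻¹) (𝓝[>] 0) (𝓝 0) :=
    tendsto_inv_atBot_zero.comp Real.tendsto_log_nhdsGT_zero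
  have hsmall : ∀ᶠ s : ℝ in 𝓝[>] 0, 0 < s ∧ Real.log s ≠ 0 := by
    filter_upwards [Ioo_mem_nhdsGT (zero_lt_one (α := ℝ))] with s hs
    exact ⟨hs.1, (Real.log_neg hs.1 hs.2).ne⟩
  set R : J → ℝ → ℝ := fun j s =>
    ((b j - b m + s) ^ (-e j) * Real.log (b j - b m + s) ^ n j) *
      (s ^ e m * (Real.log s)⁻¹ ^ n m) with hR
  have hlim : ∀ j ∈ S, Tendsto (R j) (𝓝[>] 0) (𝓝 (if j = m then 1 else 0)) := by
    intro j hj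
    split_ifs with hjm
    · subst hjm
      refine tendsto_const_nhds.congr' ?_
      filter_upwards [hsmall] with s hs
      have : s ^ (-e j) * s ^ e j = 1 := by rw [← Real.rpow_add hs.1]; simp
      have h2 : Real.log s ^ n j * (Real.log s)⁻¹ ^ n j = 1 := by
        rw [← mul_pow, mul_inv_cancel₀ hs.2, one_pow]
      simp only [hR, sub_self, zero_add]
      linear_combination (-1 : ℝ) * h2 - Real.log s ^ n j * (Real.log s)⁻¹ ^ n j * this
    · rcases hord j hj hjm with h1 | ⟨h1, h2⟩ | ⟨h1, h2, h3⟩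
      · have hp : b j - b m + 0 ≠ 0 := by linarith
        have h4 : ContinuousAt
            (fun s => (b j - b m + s) ^ (-e j) * Real.log (b j - b m + s) ^ n j) 0 := by
          have h5 : ContinuousAt (fun s => b j - b m + s) 0 := by fun_prop
          exact (h5.rpow_const (Or.inl hp)).mul ((h5.log hp).pow _)
        have h6 := (h4.tendsto.mono_left (nhdsWithin_le_nhds (s := Set.Ioi 0))).mul
          ((tendsto_rpow_mul_log_pow_nhdsGT_zero 0 (he m)).mul (hinv.pow (n m)))
        simpa [hR] using h6
      · have h6 := (tendsto_rpow_mul_log_pow_nhdsGT_zero (n j) (sub_pos.2 h2)).mul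
          (hinv.pow (n m))
        rw [zero_mul] at h6
        refine h6.congr' ?_
        filter_upwards [hsmall] with s hs
        simp only [hR, h1, sub_self, zero_add]
        rw [sub_eq_add_neg, Real.rpow_add hs.1]
        ring
      · have h6 := hinv.pow (n m - n j)
        rw [zero_pow (by omega)] at h6
        refine h6.congr' ?_
        filter_upwards [hsmall] with s hs
        have h7 : s ^ (-e m) * s ^ e m = 1 := by rw [← Real.rpow_add hs.1]; simp
        have h8 : Real.log s ^ n j * (Real.log s)⁻¹ ^ n j = 1 := by
          rw [← mul_pow, mul_inv_cancel₀ hs.2, one_pow]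
        have h9 : (Real.log s)⁻¹ ^ n m = (Real.log s)⁻¹ ^ n j * (Real.log s)⁻¹ ^ (n m - n j) := by
          rw [← pow_add]; congr 1; omega
        simp only [hR, h1, h2, sub_self, zero_add]
        rw [h9]
        linear_combination (-(Real.log s)⁻¹ ^ (n m - n j)) * h8 -
          Real.log s ^ n j * (Real.log s)⁻¹ ^ n j * (Real.log s)⁻¹ ^ (n m - n j) * h7
  have hsum := tendsto_finsetSum S fun j hj => (hlim j hj).const_mul (c j)
  have hsum0 : Tendsto (fun s => ∑ j ∈ S, c j * R j s) (𝓝[>] 0) (𝓝 0) := by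
    refine tendsto_const_nhds.congr' ?_
    filter_upwards [hsmall] with s hs
    have h1 : H (s - b m) = 0 := hzero (by simp only [Set.mem_Ioi]; linarith [hs.1])
    have h2 : ∑ j ∈ S, c j * R j s = H (s - b m) * (s ^ e m * (Real.log s)⁻¹ ^ n m) := by
      simp only [hH, hR, Finset.sum_mul]
      refine Finset.sum_congr rfl fun j _ => ?_
      rw [show b j + (s - b m) = b j - b m + s by ring]; ring
    rw [h2, h1, zero_mul]
  have hfin := tendsto_nhds_unique hsum hsum0
  exact hcm (by simpa [hmS] using hfin)

/-- If `dist ≤ ρ`, then mixing measures close to `G'` in transport distance have, after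
reindexing, weights and atoms close to those of `G'`. -/
lemma exists_reindexing_of_Wr_le {P : Type*} [MetricSpace P] {k : ℕ} (ρ : P → P → ℝ)
    (hρ : ∀ x y, dist x y ≤ ρ x y) (G' : Mix P k) {η : ℝ} (hη : 0 < η) :
    ∃ ε > (0 : ℝ), ∀ G : Mix P k, Wr ρ 1 G G' ≤ ε →
      ∃ σ : Fin k ≃ Fin k, ∀ j, |G.w (σ j) - G'.w j| < η ∧
        dist (G.atom (σ j)) (G'.atom j) < η := by
  obtain ⟨δ, hδ0, hδη, hsep⟩ : ∃ δ > (0 : ℝ), δ ≤ η ∧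
      ∀ i j, i ≠ j → 2 * δ ≤ dist (G'.atom i) (G'.atom j) := by
    have h1 : ∀ᶠ δ : ℝ in 𝓝[>] 0, ∀ i j, i ≠ j → 2 * δ ≤ dist (G'.atom i) (G'.atom j) := by
      refine eventually_all.2 fun i => eventually_all.2 fun j => ?_
      by_cases hij : i = j
      · simp [hij]
      · have hd : 0 < dist (G'.atom i) (G'.atom j) := dist_pos.2 (G'.atom_inj.ne hij)
        filter_upwards [Ioo_mem_nhdsGT (half_pos hd)] with δ hδ _
        linarith [hδ.2]
    obtain ⟨δ, h2, h3⟩ := (h1.and (Ioo_mem_nhdsGT hη)).exists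
    exact ⟨δ, h3.1, h3.2.le, h2⟩
  obtain ⟨ε, hε0, hεη, hεw⟩ : ∃ ε > (0 : ℝ), ε ≤ δ * η ∧ ∀ j, ε ≤ δ * G'.w j := by
    have h1 : ∀ᶠ ε : ℝ in 𝓝[>] 0, ∀ j, ε ≤ δ * G'.w j := by
      refine eventually_all.2 fun j => ?_
      filter_upwards [Ioo_mem_nhdsGT (mul_pos hδ0 (G'.w_pos j))] with ε hε using hε.2.le
    obtain ⟨ε, h2, h3⟩ := (h1.and (Ioo_mem_nhdsGT (mul_pos hδ0 hη))).exists
    exact ⟨ε, h3.1, h3.2.le, h2⟩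
  refine ⟨ε / 2, half_pos hε0, fun G hG => ?_⟩
  have hlt : WrPow ρ 1 G G' < ε := by
    have : Wr ρ 1 G G' = WrPow ρ 1 G G' := by simp [Wr]
    linarith
  rw [WrPow] at hlt
  obtain ⟨c, ⟨q, hq0, hrow, hcol, rfl⟩, hc⟩ := exists_lt_of_csInf_lt
    (by exact ⟨_, fun i j => G.w i * G'.w j, fun i j => (mul_pos (G.w_pos i) (G'.w_pos j)).le,
      fun i => by rw [← Finset.mul_sum, G'.w_sum, mul_one],
      fun j => by rw [← Finset.sum_mul, G.w_sum, one_mul], rfl⟩) hlt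
  simp only [Real.rpow_one] at hc
  set d : Fin k → Fin k → ℝ := fun i j => dist (G.atom i) (G'.atom j) with hd
  have hcost : ∑ i, ∑ j, q i j * d i j < ε := by
    refine lt_of_le_of_lt (Finset.sum_le_sum fun i _ => Finset.sum_le_sum fun j _ => ?_) hc
    exact mul_le_mul_of_nonneg_left (hρ _ _) (hq0 i j)
  have hqd : ∀ i j, 0 ≤ q i j * d i j := fun i j => mul_nonneg (hq0 i j) dist_nonneg
  have hcolcost : ∀ j, ∑ i, q i j * d i j < ε := by
    intro j
    refine lt_of_le_of_lt ?_ hcost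
    exact Finset.sum_le_sum fun i _ =>
      Finset.single_le_sum (f := fun j => q i j * d i j) (fun j _ => hqd i j) (Finset.mem_univ j)
  have hrowcost : ∀ i, ∑ j, q i j * d i j < ε := by
    intro i
    refine lt_of_le_of_lt ?_ hcost
    exact Finset.single_le_sum (f := fun i => ∑ j, q i j * d i j)
      (fun i _ => Finset.sum_nonneg fun j _ => hqd i j) (Finset.mem_univ i)
  have hnear : ∀ j, ∃ i, d i j < δ := by
    intro j
    by_contra! hfar
    have h1 : δ * G'.w j ≤ ∑ i, q i j * d i j := by
      rw [← hcol j, Finset.mul_sum]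
      refine Finset.sum_le_sum fun i _ => ?_
      rw [mul_comm]
      exact mul_le_mul_of_nonneg_left (hfar i) (hq0 i j)
    linarith [hcolcost j, hεw j]
  choose σ hσ using hnear
  have hfar : ∀ j j', j ≠ j' → δ ≤ d (σ j) j' := by
    intro j j' hjj
    have h1 := dist_triangle_left (G'.atom j) (G'.atom j') (G.atom (σ j))
    have h2 := hsep j j' hjj
    have h3 := hσ j
    simp only [hd] at h3 ⊢
    linarith
  have hσinj : Function.Injective σ := by
    intro j j' hjj
    by_contra hne
    have h1 := hfar j j' hne
    rw [hjj] at h1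
    linarith [hσ j']
  have hσbij : Function.Bijective σ := Finite.injective_iff_bijective.1 hσinj
  refine ⟨Equiv.ofBijective σ hσbij, fun j => ⟨?_, (hσ j).trans_le hδη⟩⟩
  change |G.w (σ j) - G'.w j| < η
  have hr : δ * (G.w (σ j) - q (σ j) j) ≤ ∑ j', q (σ j) j' * d (σ j) j' := by
    rw [← hrow (σ j), ← Finset.add_sum_erase _ _ (Finset.mem_univ j), add_sub_cancel_left,
      Finset.mul_sum, ← Finset.add_sum_erase _ (fun j' => q (σ j) j' * d (σ j) j')
      (Finset.mem_univ j)]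
    refine le_add_of_nonneg_of_le (hqd _ _) (Finset.sum_le_sum fun j' hj' => ?_)
    rw [mul_comm]
    exact mul_le_mul_of_nonneg_left (hfar j j' (Finset.ne_of_mem_erase hj').symm) (hq0 _ _)
  have hcl : δ * (G'.w j - q (σ j) j) ≤ ∑ i, q i j * d i j := by
    rw [← hcol j, ← Finset.add_sum_erase _ _ (Finset.mem_univ (σ j)), add_sub_cancel_left,
      Finset.mul_sum, ← Finset.add_sum_erase _ (fun i => q i j * d i j)
      (Finset.mem_univ (σ j))]
    refine le_add_of_nonneg_of_le (hqd _ _) (Finset.sum_le_sum fun i hi => ?_)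
    obtain ⟨j', rfl⟩ := hσbij.2 i
    rw [mul_comm]
    refine mul_le_mul_of_nonneg_left (hfar j' j fun h => ?_) (hq0 _ _)
    exact Finset.ne_of_mem_erase hi (by rw [h])
  have h1 : ∀ j, q (σ j) j ≤ G.w (σ j) := fun j => by
    rw [← hrow (σ j)]
    exact Finset.single_le_sum (f := fun j' => q (σ j) j') (fun j' _ => hq0 _ j') (Finset.mem_univ j)
  have h2 : ∀ j, q (σ j) j ≤ G'.w j := fun j => by
    rw [← hcol j]
    exact Finset.single_le_sum (f := fun i => q i j) (fun i _ => hq0 i j) (Finset.mem_univ (σ j))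
  have h3 : G.w (σ j) - q (σ j) j < η :=
    lt_of_mul_lt_mul_left (by linarith [hrowcost (σ j)]) hδ0.le
  have h4 : G'.w j - q (σ j) j < η :=
    lt_of_mul_lt_mul_left (by linarith [hcolcost j]) hδ0.le
  rw [abs_lt]
  constructor <;> linarith [h1 j, h2 j]

/-- Keeping the common mass of matched atoms in place and moving the rest arbitrarily bounds the
transport distance by the distance between the reindexed parameters. -/
lemma Wr_one_le_of_reindexing {P : Type*} [MetricSpace P] {k : ℕ} (ρ : P → P → ℝ)
    (hρ0 : ∀ x y, 0 ≤ ρ x y) (hρ : ∀ x y, ρ x y ≤ 2 * dist x y) (G G' : Mix P k)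
    (σ : Fin k ≃ Fin k) {D : ℝ} (hD : ∀ i j, dist (G.atom (σ i)) (G'.atom j) ≤ D) :
    Wr ρ 1 G G' ≤ 2 * ∑ j, (dist (G.atom (σ j)) (G'.atom j) + D * |G.w (σ j) - G'.w j|) := by
  classical
  have hWr : Wr ρ 1 G G' = WrPow ρ 1 G G' := by simp [Wr]
  rw [hWr]
  set μ : Fin k → ℝ := fun j => min (G.w (σ j)) (G'.w j) with hμ
  set u : Fin k → ℝ := fun j => G.w (σ j) - μ j with hu
  set v : Fin k → ℝ := fun j => G'.w j - μ j with hv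
  have hu0 : ∀ j, 0 ≤ u j := fun j => sub_nonneg.2 (min_le_left _ _)
  have hv0 : ∀ j, 0 ≤ v j := fun j => sub_nonneg.2 (min_le_right _ _)
  have hμ0 : ∀ j, 0 ≤ μ j := fun j => le_min (G.w_pos _).le (G'.w_pos _).le
  have hμ1 : ∀ j, μ j ≤ 1 := fun j => (min_le_right _ _).trans <| by
    rw [← G'.w_sum]
    exact Finset.single_le_sum (fun j _ => (G'.w_pos j).le) (Finset.mem_univ j)
  set M : ℝ := ∑ j, u j with hM
  have hMv : ∑ j, v j = M := by
    simp only [hM, hu, hv, Finset.sum_sub_distrib, G'.w_sum]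
    rw [Equiv.sum_comp σ G.w, G.w_sum]
  have hM0 : 0 ≤ M := Finset.sum_nonneg fun j _ => hu0 j
  have hcancel : ∀ x, 0 ≤ x → x ≤ M → x * M / M = x := by
    intro x hx0 hxM
    by_cases h : M = 0
    · have : x = 0 := le_antisymm (h ▸ hxM) hx0
      simp [this]
    · exact mul_div_cancel_right₀ x h
  set q : Fin k → Fin k → ℝ := fun i j => (if i = j then μ j else 0) + u i * v j / M with hq
  have hbdd : BddBelow { c : ℝ | ∃ q : Fin k → Fin k → ℝ,
    (∀ i j, 0 ≤ q i j) ∧ (∀ i, ∑ j, q i j = G.w i) ∧ (∀ j, ∑ i, q i j = G'.w j) ∧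
    c = ∑ i, ∑ j, q i j * ρ (G.atom i) (G'.atom j) ^ (1 : ℝ) } := by
    refine ⟨0, ?_⟩
    rintro c ⟨q, hq0, -, -, rfl⟩
    exact Finset.sum_nonneg fun i _ => Finset.sum_nonneg fun j _ =>
      mul_nonneg (hq0 i j) (Real.rpow_nonneg (hρ0 _ _) _)
  have hq0 : ∀ i j, 0 ≤ q i j := by
    intro i j
    refine add_nonneg ?_ (div_nonneg (mul_nonneg (hu0 i) (hv0 j)) hM0)
    split_ifs
    exacts [hμ0 j, le_rfl]
  have hrow : ∀ i, ∑ j, q i j = G.w (σ i) := by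
    intro i
    simp only [hq, Finset.sum_add_distrib, Finset.sum_ite_eq, Finset.mem_univ, if_true]
    rw [← Finset.sum_div, ← Finset.mul_sum, hMv, hcancel _ (hu0 i)
      (Finset.single_le_sum (fun j _ => hu0 j) (Finset.mem_univ i))]
    simp [hu]
  have hcol : ∀ j, ∑ i, q i j = G'.w j := by
    intro j
    simp only [hq, Finset.sum_add_distrib, Finset.sum_ite_eq', Finset.mem_univ, if_true]
    rw [← Finset.sum_div, ← Finset.sum_mul, ← hM, mul_comm, hcancel _ (hv0 j)
      (hMv ▸ Finset.single_le_sum (fun j _ => hv0 j) (Finset.mem_univ j))]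
    simp [hv]
  have hle : WrPow ρ 1 G G' ≤ ∑ i, ∑ j, q i j * ρ (G.atom (σ i)) (G'.atom j) := by
    refine csInf_le hbdd ⟨fun i j => q (σ.symm i) j, fun i j => hq0 _ _, fun i => ?_,
      fun j => ?_, ?_⟩
    · rw [hrow, Equiv.apply_symm_apply]
    · rw [← hcol j]
      exact Equiv.sum_comp σ.symm fun i => q i j
    · have h := Equiv.sum_comp σ fun i => ∑ j, q (σ.symm i) j * ρ (G.atom i) (G'.atom j)
      simpa only [Real.rpow_one, Equiv.symm_apply_apply] using h
  refine hle.trans ?_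
  have hterm : ∀ i j, q i j * ρ (G.atom (σ i)) (G'.atom j) ≤
      (if i = j then 2 * dist (G.atom (σ j)) (G'.atom j) else 0) + 2 * D * (u i * v j / M) := by
    intro i j
    have h1 : ρ (G.atom (σ i)) (G'.atom j) ≤ 2 * D := (hρ _ _).trans (by linarith [hD i j])
    have h2 : u i * v j / M * ρ (G.atom (σ i)) (G'.atom j) ≤ 2 * D * (u i * v j / M) := by
      rw [mul_comm]
      exact mul_le_mul_of_nonneg_right h1 (div_nonneg (mul_nonneg (hu0 i) (hv0 j)) hM0)
    simp only [hq, add_mul]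
    refine add_le_add ?_ h2
    split_ifs with hij
    · subst hij
      have := mul_le_mul (hμ1 i) (hρ (G.atom (σ i)) (G'.atom i)) (hρ0 _ _) zero_le_one
      linarith
    · simp
  have hMle : M ≤ ∑ j, |G.w (σ j) - G'.w j| := by
    refine Finset.sum_le_sum fun j _ => ?_
    simp only [hu, hμ]
    rcases le_total (G.w (σ j)) (G'.w j) with h | h
    · rw [min_eq_left h, sub_self]; exact abs_nonneg _
    · rw [min_eq_right h]; exact le_abs_self _
  calc _ ≤ ∑ i, ∑ j, ((if i = j then 2 * dist (G.atom (σ j)) (G'.atom j) else 0) +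
        2 * D * (u i * v j / M)) :=
        Finset.sum_le_sum fun i _ => Finset.sum_le_sum fun j _ => hterm i j
    _ = 2 * ∑ j, dist (G.atom (σ j)) (G'.atom j) + 2 * (D * M) := by
        simp only [Finset.sum_add_distrib, Finset.sum_ite_eq, Finset.mem_univ, if_true]
        congr 1
        · rw [Finset.mul_sum]
        · have h1 : ∀ i, ∑ j, 2 * D * (u i * v j / M) = 2 * D * u i := fun i => by
            rw [← Finset.mul_sum, ← Finset.sum_div, ← Finset.mul_sum, hMv, hcancel _ (hu0 i)
              (Finset.single_le_sum (fun j _ => hu0 j) (Finset.mem_univ i)), mul_assoc]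
          rw [Finset.sum_congr rfl fun i _ => h1 i, ← Finset.mul_sum, mul_assoc]
    _ ≤ _ := by
        rw [Finset.sum_add_distrib, ← Finset.mul_sum, mul_add]
        rcases isEmpty_or_nonempty (Fin k) with h | ⟨⟨i⟩⟩
        · simp [hM]
        · have hD0 : 0 ≤ D := dist_nonneg.trans (hD i i)
          have := mul_le_mul_of_nonneg_left hMle hD0
          linarith

lemma gammaDensity_eqOn (a b : ℝ) :
    Set.EqOn (gammaDensity a b)
      (fun x => b ^ a / Real.Gamma a * (x ^ (a - 1) * Real.exp (-(b * x)))) (Set.Ioi 0) := by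
  intro x (hx : 0 < x)
  simp only [gammaDensity, if_pos hx, mul_assoc]

lemma integrableOn_rpow_mul_exp {a r : ℝ} (ha : 0 < a) (hr : 0 < r) :
    IntegrableOn (fun x => x ^ (a - 1) * Real.exp (-(r * x))) (Set.Ioi 0) := by
  simpa using integrableOn_rpow_mul_exp_neg_mul_rpow (p := 1) (s := a - 1) (b := r)
    (by linarith) one_pos hr

lemma integrableOn_gammaDensity {a b : ℝ} (ha : 0 < a) (hb : 0 < b) :
    IntegrableOn (gammaDensity a b) (Set.Ioi 0) :=
  IntegrableOn.congr_fun ((integrableOn_rpow_mul_exp ha hb).const_mul _)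
    (gammaDensity_eqOn a b).symm measurableSet_Ioi

/-- The Laplace transform of the Gamma density is `(b / (b + t)) ^ a`. -/
lemma laplace_gammaDensity {a b t : ℝ} (ha : 0 < a) (hb : 0 < b) (ht : 0 ≤ t) :
    IntegrableOn (fun x => Real.exp (-(t * x)) * gammaDensity a b x) (Set.Ioi 0) ∧
    ∫ x in Set.Ioi 0, Real.exp (-(t * x)) * gammaDensity a b x =
      Real.exp (a * (Real.log b - Real.log (b + t))) := by
  have hbt : 0 < b + t := by linarith
  have heq : Set.EqOn (fun x => b ^ a / Real.Gamma a * (x ^ (a - 1) * Real.exp (-((b + t) * x))))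
      (fun x => Real.exp (-(t * x)) * gammaDensity a b x) (Set.Ioi 0) := by
    intro x hx
    simp only [gammaDensity_eqOn a b hx]
    rw [show -((b + t) * x) = -(t * x) + -(b * x) by ring, Real.exp_add]
    ring
  refine ⟨IntegrableOn.congr_fun ((integrableOn_rpow_mul_exp ha hbt).const_mul _) heq
    measurableSet_Ioi, ?_⟩
  rw [← setIntegral_congr_fun measurableSet_Ioi heq, integral_const_mul,
    Real.integral_rpow_mul_exp_neg_mul_Ioi ha hbt, one_div, Real.inv_rpow hbt.le, mul_sub,
    Real.exp_sub, mul_comm a, mul_comm a, ← Real.rpow_def_of_pos hb, ← Real.rpow_def_of_pos hbt]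
  have := (Real.Gamma_pos_of_pos ha).ne'
  field_simp

/-- The Laplace transform at `t` of the Gamma mixture with weights and atoms `x`. -/
def laplaceGamma {k : ℕ} (t : ℝ) (x : Fin k → ℝ × ℝ × ℝ) : ℝ :=
  ∑ i, (x i).1 * Real.exp ((x i).2.1 * (Real.log (x i).2.2 - Real.log ((x i).2.2 + t)))

lemma integrableOn_density {k : ℕ} (G : Mix (ℝ × ℝ) k)
    (hG : ∀ i, 0 < (G.atom i).1 ∧ 0 < (G.atom i).2) :
    IntegrableOn (Mix.density gammaFam G) (Set.Ioi 0) :=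
  integrable_finsetSum _ fun i _ => (integrableOn_gammaDensity (hG i).1 (hG i).2).const_mul (G.w i)

lemma laplace_density {k : ℕ} (G : Mix (ℝ × ℝ) k) (σ : Fin k ≃ Fin k)
    (hG : ∀ i, 0 < (G.atom i).1 ∧ 0 < (G.atom i).2) {t : ℝ} (ht : 0 ≤ t) :
    IntegrableOn (fun x => Real.exp (-(t * x)) * Mix.density gammaFam G x) (Set.Ioi 0) ∧
    ∫ x in Set.Ioi 0, Real.exp (-(t * x)) * Mix.density gammaFam G x =
      laplaceGamma t fun i => (G.w (σ i), G.atom (σ i)) := by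
  have heq : (fun x => Real.exp (-(t * x)) * Mix.density gammaFam G x) = fun x =>
      ∑ i, G.w i * (Real.exp (-(t * x)) * gammaDensity (G.atom i).1 (G.atom i).2 x) := by
    funext x
    simp only [Mix.density, gammaFam, Finset.mul_sum]
    exact Finset.sum_congr rfl fun i _ => by ring
  have hint : ∀ i ∈ Finset.univ, IntegrableOn (fun x =>
      G.w i * (Real.exp (-(t * x)) * gammaDensity (G.atom i).1 (G.atom i).2 x)) (Set.Ioi 0) :=
    fun i _ => (laplace_gammaDensity (hG i).1 (hG i).2 ht).1.const_mul (G.w i)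
  rw [heq]
  refine ⟨integrable_finsetSum _ hint, ?_⟩
  rw [integral_finsetSum _ hint, laplaceGamma, Equiv.sum_comp σ fun i => G.w i *
    Real.exp ((G.atom i).1 * (Real.log (G.atom i).2 - Real.log ((G.atom i).2 + t)))]
  exact Finset.sum_congr rfl fun i _ => by
    rw [integral_const_mul, (laplace_gammaDensity (hG i).1 (hG i).2 ht).2]

/-- The Laplace transform is a bounded test function, so it is controlled by total variation. -/
lemma abs_laplaceGamma_sub_le {k : ℕ} (G G' : Mix (ℝ × ℝ) k) (σ : Fin k ≃ Fin k)
    (hG : ∀ i, 0 < (G.atom i).1 ∧ 0 < (G.atom i).2)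
    (hG' : ∀ i, 0 < (G'.atom i).1 ∧ 0 < (G'.atom i).2) {t : ℝ} (ht : 0 ≤ t) :
    |laplaceGamma t (fun i => (G.w (σ i), G.atom (σ i))) -
      laplaceGamma t (fun i => (G'.w i, G'.atom i))| ≤
      2 * TVline (Set.Ioi 0) (Mix.density gammaFam G) (Mix.density gammaFam G') := by
  have h1 := laplace_density G σ hG ht
  have h2 := laplace_density G' (Equiv.refl _) hG' ht
  simp only [Equiv.refl_apply] at h2
  rw [← h1.2, ← h2.2, ← integral_sub h1.1 h2.1, TVline]
  refine (abs_integral_le_integral_abs).trans ?_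
  rw [← mul_assoc, mul_one_div_cancel two_ne_zero, one_mul]
  refine setIntegral_mono_on (h1.1.sub h2.1).abs
    ((integrableOn_density G hG).sub (integrableOn_density G' hG')).abs measurableSet_Ioi ?_
  intro x (hx : 0 < x)
  rw [← mul_sub, abs_mul, abs_of_pos (Real.exp_pos _)]
  refine mul_le_of_le_one_left (abs_nonneg _) (Real.exp_le_one_iff.2 ?_)
  have := mul_nonneg ht hx.le
  linarith

/-- The differential at `x₀` of the Laplace transform of a Gamma mixture. -/
lemma exists_hasFDerivAt_laplaceGamma {k : ℕ} {t : ℝ} (ht : 0 ≤ t) (x₀ : Fin k → ℝ × ℝ × ℝ)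
    (hb : ∀ i, 0 < (x₀ i).2.2) :
    ∃ L : (Fin k → ℝ × ℝ × ℝ) →L[ℝ] ℝ, HasFDerivAt (laplaceGamma t) L x₀ ∧ ∀ v, L v =
      ∑ i, Real.exp ((x₀ i).2.1 * (Real.log (x₀ i).2.2 - Real.log ((x₀ i).2.2 + t))) *
        ((v i).1 + (x₀ i).1 * ((v i).2.1 * (Real.log (x₀ i).2.2 - Real.log ((x₀ i).2.2 + t)) +
          (x₀ i).2.1 * (v i).2.2 * ((x₀ i).2.2⁻¹ - ((x₀ i).2.2 + t)⁻¹))) := by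
  have hpi : ∀ i, HasFDerivAt (fun x : Fin k → ℝ × ℝ × ℝ => x i)
      (ContinuousLinearMap.proj (R := ℝ) (φ := fun _ : Fin k => ℝ × ℝ × ℝ) i) x₀ :=
    fun i => (ContinuousLinearMap.proj (R := ℝ) (φ := fun _ : Fin k => ℝ × ℝ × ℝ) i).hasFDerivAt
  have hterm := fun i (_ : i ∈ Finset.univ) =>
    (hpi i).fst.mul ((hpi i).snd.fst.mul (((hpi i).snd.snd.log (hb i).ne').sub
      (((hpi i).snd.snd.add_const t).log (by have := hb i; positivity)))).exp
  refine ⟨_, HasFDerivAt.fun_sum hterm, fun v => ?_⟩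
  simp only [_root_.sum_apply]
  refine Finset.sum_congr rfl fun i _ => ?_
  simp
  ring

/-- In finite dimension, a separating family of linear forms has a finite separating subfamily. -/
lemma exists_finset_separating {E ι : Type*} [AddCommGroup E] [Module ℝ E]
    [FiniteDimensional ℝ E] (L : ι → E →ₗ[ℝ] ℝ) (hL : ∀ v, (∀ i, L i v = 0) → v = 0) :
    ∃ T : Finset ι, ∀ v, (∀ i ∈ T, L i v = 0) → v = 0 := by
  classical
  obtain ⟨-, ⟨T, rfl⟩, hT⟩ := (wellFounded_lt (α := Submodule ℝ E)).has_min
    (Set.range fun T : Finset ι => ⨅ i ∈ T, LinearMap.ker (L i)) (Set.range_nonempty _)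
  refine ⟨T, fun v hv => hL v fun i => ?_⟩
  have hvT : v ∈ ⨅ i ∈ T, LinearMap.ker (L i) := by simpa using hv
  by_contra hne
  refine hT _ ⟨insert i T, rfl⟩ (lt_of_le_of_ne ?_ fun heq => hne ?_)
  · exact biInf_mono fun j hj => Finset.mem_insert_of_mem hj
  · have h1 : v ∈ ⨅ j ∈ insert i T, LinearMap.ker (L j) := heq.symm.le hvT
    simp only [Submodule.mem_iInf, LinearMap.mem_ker] at h1
    exact h1 i (Finset.mem_insert_self i T)

/-- Under the genericity condition, the differential of the Laplace transforms of a Gamma mixture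
has trivial kernel. -/
lemma eq_zero_of_laplaceGamma_deriv_eq_zero {k : ℕ} (w a b : Fin k → ℝ) (hw : ∀ i, 0 < w i)
    (ha : ∀ i, 0 < a i) (hb : ∀ i, 0 < b i) (hinj : ∀ i j, a i = a j → b i = b j → i = j)
    (hgen : ∀ i j, b i = b j → a i ≠ a j + 1) (v : Fin k → ℝ × ℝ × ℝ)
    (h : ∀ t : ℝ, 0 < t → ∑ i, Real.exp (a i * (Real.log (b i) - Real.log (b i + t))) *
        ((v i).1 + w i * ((v i).2.1 * (Real.log (b i) - Real.log (b i + t)) +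
          a i * (v i).2.2 * ((b i)⁻¹ - (b i + t)⁻¹))) = 0) : v = 0 := by
  have key := coeff_eq_zero_of_sum_rpow_log_eq_zero (J := Fin k × Fin 3)
    (fun j => b j.1) (fun j => ![a j.1, a j.1, a j.1 + 1] j.2) (fun j => ![0, 1, 0] j.2)
    (by
      rintro ⟨i, l⟩
      have := ha i
      fin_cases l <;> simp <;> linarith)
    (by
      rintro ⟨i, l⟩ ⟨j, m⟩ hij
      have h1 := hgen i j
      have h2 := hgen j i
      have h3 := hinj i j
      fin_cases l <;> fin_cases m <;> simp at hij ⊢ <;> grind)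
    (fun j => b j.1 ^ a j.1 * ![(v j.1).1 + w j.1 * (v j.1).2.1 * Real.log (b j.1) +
      w j.1 * a j.1 * (v j.1).2.2 * (b j.1)⁻¹, -(w j.1 * (v j.1).2.1),
      -(w j.1 * a j.1 * (v j.1).2.2)] j.2)
    (fun j => hb j.1)
    (by
      intro t ht
      rw [Fintype.sum_prod_type, ← h t ht]
      refine Finset.sum_congr rfl fun i _ => ?_
      have hbt : 0 < b i + t := add_pos (hb i) ht
      have h1 : Real.exp (a i * (Real.log (b i) - Real.log (b i + t))) =
          b i ^ a i * (b i + t) ^ (-a i) := by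
        rw [Real.rpow_def_of_pos (hb i), Real.rpow_def_of_pos hbt, ← Real.exp_add]
        congr 1
        ring
      have h2 : (b i + t) ^ (-(a i + 1)) = (b i + t) ^ (-a i) * (b i + t)⁻¹ := by
        rw [neg_add, Real.rpow_add hbt, Real.rpow_neg_one]
      simp only [Fin.sum_univ_three, Matrix.cons_val_zero, Matrix.cons_val_one,
        Matrix.cons_val, h1, h2, pow_zero, pow_one]
      ring)
  funext i
  have hba : b i ^ a i ≠ 0 := (Real.rpow_pos_of_pos (hb i) _).ne'
  have h0 := key (i, 0)
  have h1 := key (i, 1)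
  have h2 := key (i, 2)
  simp [hba, (hw i).ne', (ha i).ne'] at h0 h1 h2
  simp [h1, h2] at h0
  exact Prod.ext h0 (Prod.ext h1 h2)

/-- If the Laplace transforms have a differential with trivial kernel, then finitely many of them
control the distance of parameters near `x₀`. -/
lemma exists_norm_sub_le_laplaceGamma {k : ℕ} (x₀ : Fin k → ℝ × ℝ × ℝ)
    (hw : ∀ i, 0 < (x₀ i).1) (ha : ∀ i, 0 < (x₀ i).2.1) (hb : ∀ i, 0 < (x₀ i).2.2)
    (hinj : ∀ i j, (x₀ i).2.1 = (x₀ j).2.1 → (x₀ i).2.2 = (x₀ j).2.2 → i = j)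
    (hgen : ∀ i j, (x₀ i).2.2 = (x₀ j).2.2 → (x₀ i).2.1 ≠ (x₀ j).2.1 + 1) :
    ∃ C > (0 : ℝ), ∃ η > (0 : ℝ), ∀ x, dist x x₀ < η → ∀ B : ℝ, 0 ≤ B →
      (∀ t : ℝ, 0 ≤ t → |laplaceGamma t x - laplaceGamma t x₀| ≤ B) → dist x x₀ ≤ C * B := by
  choose L hL hLv using fun t : Set.Ioi (0 : ℝ) =>
    exists_hasFDerivAt_laplaceGamma (le_of_lt t.2) x₀ hb
  obtain ⟨T, hT⟩ := exists_finset_separating (fun t => (L t).toLinearMap) fun v hv =>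
    eq_zero_of_laplaceGamma_deriv_eq_zero (fun i => (x₀ i).1) (fun i => (x₀ i).2.1)
      (fun i => (x₀ i).2.2) hw ha hb hinj hgen v fun t ht => by
        rw [← hLv ⟨t, ht⟩ v]
        exact hv ⟨t, ht⟩
  have hF : HasFDerivAt (fun x (t : T) => laplaceGamma (t : Set.Ioi (0 : ℝ)) x)
      (ContinuousLinearMap.pi fun t : T => L t) x₀ := hasFDerivAt_pi.2 fun t => hL t
  set A := ContinuousLinearMap.pi fun t : T => L t with hA
  obtain ⟨K, -, hK⟩ := LinearMap.exists_antilipschitzWith A.toLinearMap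
    (LinearMap.ker_eq_bot'.2 fun v hv => hT v fun t ht => congrFun hv ⟨t, ht⟩)
  have hind : Topology.IsInducing A := (hK.isUniformInducing A.uniformContinuous).isInducing
  obtain ⟨C, hC, hbound⟩ := (hF.isTheta_sub hind).2.exists_pos
  obtain ⟨η, hη, hball⟩ := Metric.eventually_nhds_iff.1 hbound.bound
  refine ⟨C, hC, η, hη, fun x hx B hB hxB => ?_⟩
  rw [dist_eq_norm]
  refine (hball hx).trans (mul_le_mul_of_nonneg_left ?_ hC.le)
  exact (pi_norm_le_iff_of_nonneg hB).2 fun t => hxB _ (le_of_lt (t : Set.Ioi (0 : ℝ)).2)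

lemma dist_le_pairDist (p q : ℝ × ℝ) : dist p q ≤ pairDist p q := by
  rw [Prod.dist_eq, Real.dist_eq, Real.dist_eq]
  exact max_le (Real.abs_le_sqrt (by nlinarith [sq_nonneg (p.2 - q.2)]))
    (Real.abs_le_sqrt (by nlinarith [sq_nonneg (p.1 - q.1)]))

lemma pairDist_le_two_mul_dist (p q : ℝ × ℝ) : pairDist p q ≤ 2 * dist p q := by
  have h1 : |p.1 - q.1| ≤ dist p q := (Real.dist_eq _ _) ▸ le_max_left _ _
  have h2 : |p.2 - q.2| ≤ dist p q := (Real.dist_eq _ _) ▸ le_max_right _ _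
  have h0 : 0 ≤ dist p q := dist_nonneg
  refine Real.sqrt_le_iff.2 ⟨by positivity, ?_⟩
  have h3 := sq_le_sq.2 ((abs_abs _).trans_le (h1.trans (le_abs_self _)))
  have h4 := sq_le_sq.2 ((abs_abs _).trans_le (h2.trans (le_abs_self _)))
  rw [sq_abs] at h3 h4
  nlinarith [sq_nonneg (dist p q)]

/-- **Theorem 5.2(a)** (exact-fitted Gamma mixtures, generic case): if all shapes
`a_i⁰ ≥ 1` and no pair of atoms has `{|Δa|,|Δb|} = {1,0}`, then
`V(p_G,p_{G₀}) ≥ C₀ W₁(G,G₀)` for all `G ∈ E_{k₀}(Θ)` with `W₁(G,G₀) ≤ ε₀`. -/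
theorem exact_fitted_gamma_generic
    (Θ : Set (ℝ × ℝ)) (hΘ : Θ ⊆ Set.Ioi (0 : ℝ) ×ˢ Set.Ioi (0 : ℝ))
    (k₀ : ℕ) (hk₀ : 2 ≤ k₀)
    (G₀ : Mix (ℝ × ℝ) k₀) (hmem : ∀ i, G₀.atom i ∈ Θ)
    (ha : ∀ i, 1 ≤ (G₀.atom i).1)
    (hgen : ∀ i j,
      ({|(G₀.atom i).1 - (G₀.atom j).1|, |(G₀.atom i).2 - (G₀.atom j).2|} : Set ℝ)
        ≠ ({1, 0} : Set ℝ)) :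
    ∃ ε₀ > (0 : ℝ), ∃ C₀ > (0 : ℝ),
      ∀ G : Mix (ℝ × ℝ) k₀, (∀ i, G.atom i ∈ Θ) →
        Wr pairDist 1 G G₀ ≤ ε₀ →
        C₀ * Wr pairDist 1 G G₀
          ≤ TVline (Set.Ioi 0) (Mix.density gammaFam G) (Mix.density gammaFam G₀) := by
  have hpos₀ : ∀ i, 0 < (G₀.atom i).1 ∧ 0 < (G₀.atom i).2 := fun i => hΘ (hmem i)
  obtain ⟨C, hC, η, hη, hloc⟩ := exists_norm_sub_le_laplaceGamma
    (fun i => (G₀.w i, G₀.atom i)) G₀.w_pos (fun i => (hpos₀ i).1) (fun i => (hpos₀ i).2)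
    (fun i j h1 h2 => G₀.atom_inj (Prod.ext h1 h2))
    (fun i j h1 h2 => hgen i j (by
      simp only at h1 h2
      simp [h1, h2]))
  obtain ⟨ε, hε, hmatch⟩ := exists_reindexing_of_Wr_le pairDist dist_le_pairDist G₀
    (lt_min hη one_pos)
  obtain ⟨D, hD⟩ : ∃ D : ℝ, ∀ i j, dist (G₀.atom i) (G₀.atom j) ≤ D :=
    ⟨Metric.diam (Set.range G₀.atom), fun i j => Metric.dist_le_diam_of_mem
      (Set.finite_range _).isBounded ⟨i, rfl⟩ ⟨j, rfl⟩⟩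
  have i₀ : Fin k₀ := ⟨0, by omega⟩
  have hD0 : 0 ≤ D := dist_nonneg.trans (hD i₀ i₀)
  have hk : (0 : ℝ) < k₀ := by exact_mod_cast (by omega : 0 < k₀)
  set K : ℝ := 2 * (k₀ * (1 + (1 + D))) * C * 2 with hK
  have hKpos : 0 < K := by positivity
  refine ⟨ε, hε, K⁻¹, inv_pos.2 hKpos, fun G hG hW => ?_⟩
  have hpos : ∀ i, 0 < (G.atom i).1 ∧ 0 < (G.atom i).2 := fun i => hΘ (hG i)
  obtain ⟨σ, hσ⟩ := hmatch G hW
  set x : Fin k₀ → ℝ × ℝ × ℝ := fun i => (G.w (σ i), G.atom (σ i)) with hx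
  set x₀ : Fin k₀ → ℝ × ℝ × ℝ := fun i => (G₀.w i, G₀.atom i) with hx₀
  have hxη : dist x x₀ < η := (dist_pi_lt_iff hη).2 fun i => by
    rw [Prod.dist_eq, Real.dist_eq]
    exact max_lt ((hσ i).1.trans_le (min_le_left _ _)) ((hσ i).2.trans_le (min_le_left _ _))
  set V := TVline (Set.Ioi 0) (Mix.density gammaFam G) (Mix.density gammaFam G₀) with hV
  have hV0 : 0 ≤ V :=
    mul_nonneg (by norm_num) (integral_nonneg fun x => abs_nonneg _)
  have hdist : dist x x₀ ≤ C * (2 * V) := hloc x hxη _ (by positivity) fun t ht =>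
    abs_laplaceGamma_sub_le G G₀ σ hpos hpos₀ ht
  have hcoord : ∀ j, |G.w (σ j) - G₀.w j| ≤ dist x x₀ ∧
      dist (G.atom (σ j)) (G₀.atom j) ≤ dist x x₀ := fun j => by
    have h1 := dist_le_pi_dist x x₀ j
    rw [Prod.dist_eq, Real.dist_eq] at h1
    exact max_le_iff.1 h1
  have hWr := Wr_one_le_of_reindexing pairDist (fun _ _ => Real.sqrt_nonneg _)
    pairDist_le_two_mul_dist G G₀ σ (D := 1 + D) fun i j =>
      (dist_triangle _ (G₀.atom i) _).trans
        (add_le_add ((hσ i).2.le.trans (min_le_right _ _)) (hD i j))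
  have hsum : ∑ j, (dist (G.atom (σ j)) (G₀.atom j) + (1 + D) * |G.w (σ j) - G₀.w j|) ≤
      ∑ _j : Fin k₀, (1 + (1 + D)) * dist x x₀ := Finset.sum_le_sum fun j _ => by
    have := mul_le_mul_of_nonneg_left (hcoord j).1 (by positivity : 0 ≤ 1 + D)
    linarith [(hcoord j).2]
  rw [Finset.sum_const, Finset.card_univ, Fintype.card_fin, nsmul_eq_mul] at hsum
  rw [inv_mul_le_iff₀ hKpos]
  calc Wr pairDist 1 G G₀ ≤ 2 * (k₀ * ((1 + (1 + D)) * dist x x₀)) := by linarith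
    _ ≤ 2 * (k₀ * ((1 + (1 + D)) * (C * (2 * V)))) := by gcongr
    _ = K * V := by rw [hK]; ring
end
end

section
/- Exact-fitted Gamma mixtures, pathological case (Theorem 5.2(b)): Let f(x|a,b) = (b^a/Γ(a)) x^{a−1} e^{−bx} for x > 0 be the Gamma density. Let Θ ⊂ (0,∞)², k₀ ≥ 2, and let G₀ = Σ_{i=1}^{k₀} p_i⁰ δ_{(a_i⁰,b_i⁰)} ∈ E_{k₀}(Θ) be such that all atoms lie in the interior of Θ, a_i⁰ ≥ 1 for all i, and there exist indices i ≠ j with b_i⁰ = b_j⁰ and |a_i⁰ − a_j⁰| = 1. Then for every r ≥ 1: lim_{ε→0⁺} inf{ V(p_G, p_{G₀}) / W_r(G, G₀)^r : G ∈ E_{k₀}(Θ), 0 < W_r(G, G₀) ≤ ε } = 0. In particular the total variation distance between the mixture densities cannot be bounded below by any constant multiple of W_r(G,G₀)^r near G₀. -/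
open MeasureTheory

noncomputable section

lemma pairDist_nonneg (p q : ℝ × ℝ) : 0 ≤ pairDist p q := Real.sqrt_nonneg _

lemma pairDist_pos {p q : ℝ × ℝ} (h : p ≠ q) : 0 < pairDist p q := by
  refine Real.sqrt_pos.2 ?_
  by_contra! hle
  have h1 : p.1 - q.1 = 0 := by nlinarith [sq_nonneg (p.1 - q.1), sq_nonneg (p.2 - q.2)]
  have h2 : p.2 - q.2 = 0 := by nlinarith [sq_nonneg (p.1 - q.1), sq_nonneg (p.2 - q.2)]
  exact h (Prod.ext (sub_eq_zero.1 h1) (sub_eq_zero.1 h2))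

lemma exp_neg_le_quadratic {y : ℝ} (hy : 0 ≤ y) : Real.exp (-y) ≤ 1 - y + y ^ 2 := by
  have h1 : y + 1 ≤ Real.exp y := Real.add_one_le_exp y
  have h2 : Real.exp (-y) * Real.exp y = 1 := by rw [← Real.exp_add]; simp
  have h3 : 0 < Real.exp (-y) := Real.exp_pos _
  have h4 : Real.exp (-y) * (y + 1) ≤ 1 := by nlinarith
  nlinarith [pow_nonneg hy 3]

/-- Second-order expansion of the factor by which the normalising constant changes. -/
lemma abs_one_sub_mul_one_add_rpow_sub_one_le {a s : ℝ} (ha : 1 ≤ a) (hs : 0 ≤ s)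
    (has : a * s ≤ 1) : |(1 - a * s) * (1 + s) ^ a - 1| ≤ (a * s) ^ 2 := by
  have h1 : 1 + a * s ≤ (1 + s) ^ a := one_add_mul_self_le_rpow_one_add (by linarith) ha
  have h2 : (1 + s) ^ a ≤ Real.exp (a * s) := by
    calc (1 + s) ^ a ≤ (Real.exp s) ^ a :=
          Real.rpow_le_rpow (by linarith) (by linarith [Real.add_one_le_exp s]) (by linarith)
      _ = Real.exp (a * s) := by rw [← Real.exp_mul, mul_comm]
  have h3 : 1 - a * s ≤ Real.exp (-(a * s)) := by linarith [Real.add_one_le_exp (-(a * s))]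
  have h4 : Real.exp (-(a * s)) * Real.exp (a * s) = 1 := by rw [← Real.exp_add]; simp
  have h5 : (1 - a * s) * (1 + s) ^ a ≤ 1 := by
    calc (1 - a * s) * (1 + s) ^ a ≤ Real.exp (-(a * s)) * Real.exp (a * s) :=
          mul_le_mul h3 h2 (by positivity) (Real.exp_pos _).le
      _ = 1 := h4
  rw [abs_le]
  constructor <;> nlinarith [sq_nonneg (a * s)]

lemma gammaDensity_nonneg {a b : ℝ} (ha : 0 < a) (hb : 0 < b) (x : ℝ) :
    0 ≤ gammaDensity a b x := by
  unfold gammaDensity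
  split_ifs with hx
  · have := Real.Gamma_pos_of_pos ha
    positivity
  · exact le_rfl

/-- Raising the shape by one multiplies the Gamma density by `b * x / a`. -/
lemma gammaDensity_add_one {a b x : ℝ} (ha : 0 < a) (hb : 0 < b) (hx : 0 < x) :
    gammaDensity (a + 1) b x = b / a * x * gammaDensity a b x := by
  have hG := (Real.Gamma_pos_of_pos ha).ne'
  simp only [gammaDensity, if_pos hx]
  rw [Real.Gamma_add_one ha.ne', Real.rpow_add_one hb.ne',
    show a + 1 - 1 = (a - 1) + 1 by ring, Real.rpow_add_one hx.ne']
  field_simp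

lemma gammaDensity_rate_add {a b t x : ℝ} (hb : 0 < b) (ht : 0 ≤ t) (hx : 0 < x) :
    gammaDensity a (b + t) x
      = (1 + t / b) ^ a * Real.exp (-(t * x)) * gammaDensity a b x := by
  simp only [gammaDensity, if_pos hx]
  have h1 : b + t = b * (1 + t / b) := by field_simp
  have h2 : Real.exp (-((b + t) * x)) = Real.exp (-(b * x)) * Real.exp (-(t * x)) := by
    rw [← Real.exp_add]; ring_nf
  rw [h2, h1, Real.mul_rpow hb.le (by positivity)]
  ring

/-- Perturbing the rate is compensated, up to second order, by moving mass from the shape `a`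
to the shape `a + 1`. -/
lemma abs_gammaDensity_perturbation_le {a b p t x : ℝ} (ha : 1 ≤ a) (hb : 0 < b) (hp : 0 ≤ p)
    (ht : 0 ≤ t) (hat : a / b * t ≤ 1) (hx : 0 < x) :
    |(p - p * (a / b) * t) * gammaDensity a (b + t) x
        + p * (a / b) * t * gammaDensity (a + 1) b x - p * gammaDensity a b x|
      ≤ t ^ 2 * (p * ((a / b) ^ 2 + x ^ 2) * gammaDensity a b x) := by
  have ha0 : 0 < a := by linarith
  have hf := gammaDensity_nonneg ha0 hb x
  rw [gammaDensity_rate_add hb ht hx, gammaDensity_add_one ha0 hb hx]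
  set f := gammaDensity a b x
  set e := Real.exp (-(t * x))
  have hs : a * (t / b) = a / b * t := by ring
  have hu := abs_one_sub_mul_one_add_rpow_sub_one_le ha (div_nonneg ht hb.le) (hs ▸ hat)
  rw [hs] at hu
  set u := (1 + t / b) ^ a
  have hid : (p - p * (a / b) * t) * (u * e * f) + p * (a / b) * t * (b / a * x * f) - p * f
      = (p * f) * (((1 - a / b * t) * u - 1) * e + (e - 1 + t * x)) := by
    field_simp
    ring
  have he0 : 0 < e := Real.exp_pos _
  have he1 : e ≤ 1 := Real.exp_le_one_iff.2 (by have := mul_nonneg ht hx.le; linarith)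
  have he2 : e ≤ 1 - t * x + (t * x) ^ 2 := exp_neg_le_quadratic (mul_nonneg ht hx.le)
  have he3 : 1 - t * x ≤ e := by linarith [Real.add_one_le_exp (-(t * x))]
  have hb1 : |((1 - a / b * t) * u - 1) * e| ≤ (a / b * t) ^ 2 := by
    rw [abs_mul, abs_of_pos he0]
    nlinarith [abs_nonneg ((1 - a / b * t) * u - 1)]
  have hb2 : |e - 1 + t * x| ≤ (t * x) ^ 2 := by
    rw [abs_of_nonneg (by linarith)]; linarith
  rw [hid, abs_mul, abs_of_nonneg (mul_nonneg hp hf)]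
  calc p * f * |((1 - a / b * t) * u - 1) * e + (e - 1 + t * x)|
      ≤ p * f * ((a / b * t) ^ 2 + (t * x) ^ 2) :=
        mul_le_mul_of_nonneg_left ((abs_add_le _ _).trans (add_le_add hb1 hb2))
          (mul_nonneg hp hf)
    _ = _ := by ring

lemma integrableOn_quadratic_mul_gammaDensity {a b : ℝ} (ha : 0 < a) (hb : 0 < b) (p K : ℝ) :
    IntegrableOn (fun x => p * (K + x ^ 2) * gammaDensity a b x) (Set.Ioi 0) := by
  have h1 := integrableOn_rpow_mul_exp_neg_mul_rpow (s := a - 1) (p := 1) (b := b)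
    (by linarith) one_pos hb
  have h2 := integrableOn_rpow_mul_exp_neg_mul_rpow (s := a - 1 + 2) (p := 1) (b := b)
    (by linarith) one_pos hb
  refine IntegrableOn.congr_fun ((h1.const_mul (p * K * (b ^ a / Real.Gamma a))).add
    (h2.const_mul (p * (b ^ a / Real.Gamma a)))) ?_ measurableSet_Ioi
  intro x hx
  have hx : 0 < x := hx
  simp only [gammaDensity, if_pos hx, Pi.add_apply, Real.rpow_one, Real.rpow_add hx (a - 1) 2,
    Real.rpow_two, neg_mul]
  ring

lemma bddBelow_transport_costs {k k' : ℕ} (r : ℝ) (G : Mix (ℝ × ℝ) k) (G' : Mix (ℝ × ℝ) k') :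
    BddBelow { c : ℝ | ∃ q : Fin k → Fin k' → ℝ,
      (∀ i j, 0 ≤ q i j) ∧ (∀ i, ∑ j, q i j = G.w i) ∧ (∀ j, ∑ i, q i j = G'.w j) ∧
      c = ∑ i, ∑ j, q i j * pairDist (G.atom i) (G'.atom j) ^ r } := by
  refine ⟨0, ?_⟩
  rintro c ⟨q, hq, -, -, rfl⟩
  exact Finset.sum_nonneg fun i _ => Finset.sum_nonneg fun j _ =>
    mul_nonneg (hq i j) (Real.rpow_nonneg (pairDist_nonneg _ _) _)

/-- Excess mass of `G` at the `j`-th atom must travel to the other atoms of `G'`. -/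
lemma excess_mass_mul_le_WrPow {k k' : ℕ} {r d : ℝ} (hd : 0 ≤ d)
    (G : Mix (ℝ × ℝ) k) (G' : Mix (ℝ × ℝ) k') (j : Fin k) (j' : Fin k')
    (hdist : ∀ l, l ≠ j' → d ≤ pairDist (G.atom j) (G'.atom l) ^ r) :
    (G.w j - G'.w j') * d ≤ WrPow pairDist r G G' := by
  refine le_csInf ⟨_, fun i l => G.w i * G'.w l,
    fun i l => mul_nonneg (G.w_pos i).le (G'.w_pos l).le,
    fun i => by rw [← Finset.mul_sum, G'.w_sum, mul_one],
    fun l => by rw [← Finset.sum_mul, G.w_sum, one_mul], rfl⟩ ?_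
  rintro c ⟨q, hq, hrow, hcol, rfl⟩
  have hterm : ∀ i l, 0 ≤ q i l * pairDist (G.atom i) (G'.atom l) ^ r := fun i l =>
    mul_nonneg (hq i l) (Real.rpow_nonneg (pairDist_nonneg _ _) _)
  have hle : q j j' ≤ G'.w j' := by
    rw [← hcol j']
    exact Finset.single_le_sum (f := fun i => q i j') (fun i _ => hq i j') (Finset.mem_univ j)
  have hsplit : q j j' + ∑ l ∈ Finset.univ.erase j', q j l = G.w j := by
    rw [← hrow j]
    exact Finset.add_sum_erase _ (fun l => q j l) (Finset.mem_univ j')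
  calc (G.w j - G'.w j') * d ≤ (∑ l ∈ Finset.univ.erase j', q j l) * d :=
        mul_le_mul_of_nonneg_right (by linarith) hd
    _ = ∑ l ∈ Finset.univ.erase j', q j l * d := Finset.sum_mul _ _ _
    _ ≤ ∑ l ∈ Finset.univ.erase j', q j l * pairDist (G.atom j) (G'.atom l) ^ r :=
        Finset.sum_le_sum fun l hl =>
          mul_le_mul_of_nonneg_left (hdist l (Finset.ne_of_mem_erase hl)) (hq j l)
    _ ≤ ∑ l, q j l * pairDist (G.atom j) (G'.atom l) ^ r :=
        Finset.sum_le_sum_of_subset_of_nonneg (Finset.erase_subset _ _) fun l _ _ => hterm j l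
    _ ≤ _ := Finset.single_le_sum
        (f := fun i => ∑ l, q i l * pairDist (G.atom i) (G'.atom l) ^ r)
        (fun i _ => Finset.sum_nonneg fun l _ => hterm i l) (Finset.mem_univ j)

/-- Move the `i`-th atom to `θ` and shift the mass `m` from the `i`-th to the `j`-th atom. -/
def Mix.shift {P : Type*} {k : ℕ} (G : Mix P k) (i j : Fin k) (hij : i ≠ j) (θ : P) (m : ℝ)
    (hm : 0 ≤ m) (hmi : m < G.w i) (hθ : ∀ l, l ≠ i → θ ≠ G.atom l) : Mix P k where
  w l := G.w l + ((if l = j then m else 0) - if l = i then m else 0)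
  atom := Function.update G.atom i θ
  w_pos l := by
    have := G.w_pos l
    rcases eq_or_ne l i with rfl | hi
    · simp [hij, hmi]
    · rcases eq_or_ne l j with rfl | hj
      · simp [hi]; linarith
      · simp [hi, hj, this]
  w_sum := by simp [Finset.sum_add_distrib, G.w_sum]
  atom_inj := by
    intro l l' h
    by_cases hl : l = i <;> by_cases hl' : l' = i
    · rw [hl, hl']
    · subst hl; simp [Function.update_of_ne hl'] at h; exact absurd h (hθ _ hl')
    · subst hl'; simp [Function.update_of_ne hl] at h; exact absurd h.symm (hθ _ hl)
    · rw [Function.update_of_ne hl, Function.update_of_ne hl'] at h; exact G.atom_inj h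

section shift

variable {k : ℕ} (G : Mix (ℝ × ℝ) k) (i j : Fin k) (hij : i ≠ j) (θ : ℝ × ℝ) (m : ℝ)
  (hm : 0 ≤ m) (hmi : m < G.w i) (hθ : ∀ l, l ≠ i → θ ≠ G.atom l)

lemma WrPow_shift_le {r : ℝ} (hr : 0 < r) :
    WrPow pairDist r (G.shift i j hij θ m hm hmi hθ) G
      ≤ (G.w i - m) * pairDist θ (G.atom i) ^ r
        + m * pairDist (G.atom j) (G.atom i) ^ r := by
  have hself : ∀ p : ℝ × ℝ, pairDist p p ^ r = 0 := fun p => by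
    simp [pairDist, Real.zero_rpow hr.ne']
  refine csInf_le (bddBelow_transport_costs r _ _) ⟨fun l l' =>
    (if l = l' then G.w l - (if l = i then m else 0) else 0)
      + if l = j then (if l' = i then m else 0) else 0, ?_, ?_, ?_, ?_⟩
  · intro l l'
    refine add_nonneg ?_ ?_
    · have := G.w_pos l
      split_ifs with _ hi
      · rw [hi]; linarith
      · linarith
      · exact le_rfl
    · split_ifs <;> simp [hm]
  · intro l
    by_cases hl : l = j <;> simp [Mix.shift, Finset.sum_add_distrib, hl] <;> ring
  · intro l'
    simp [Finset.sum_add_distrib]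
  · have hmoved : ∑ l, (G.w l - if l = i then m else 0)
          * pairDist ((G.shift i j hij θ m hm hmi hθ).atom l) (G.atom l) ^ r
        = (G.w i - m) * pairDist θ (G.atom i) ^ r := by
      rw [Finset.sum_eq_single i]
      · simp [Mix.shift]
      · intro l _ hl
        simp [Mix.shift, hl, hself]
      · simp
    rw [← hmoved]
    simp [add_mul, Finset.sum_add_distrib, ite_mul, Finset.sum_ite_irrel]
    simp [Mix.shift, hij.symm]

lemma density_shift_sub (f : ℝ × ℝ → ℝ → ℝ) (x : ℝ) :
    Mix.density f (G.shift i j hij θ m hm hmi hθ) x - Mix.density f G x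
      = (G.w i - m) * f θ x + m * f (G.atom j) x - G.w i * f (G.atom i) x := by
  unfold Mix.density
  rw [← Finset.sum_sub_distrib, Finset.sum_eq_add i j hij]
  · simp [Mix.shift, hij, hij.symm]; ring
  · intro l _ hl
    simp [Mix.shift, hl.1, hl.2]
  · simp
  · simp

end shift

/-- **Theorem 5.2(b)** (exact-fitted Gamma mixtures, pathological case): if some
two atoms of `G₀` satisfy `b_i⁰ = b_j⁰` and `|a_i⁰ − a_j⁰| = 1`, then for every
`r ≥ 1`,
`lim_{ε→0} inf { V(p_G,p_{G₀})/W_r(G,G₀)^r : G ∈ E_{k₀}(Θ), 0 < W_r(G,G₀) ≤ ε } = 0`. -/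
theorem exact_fitted_gamma_pathological
    (Θ : Set (ℝ × ℝ)) (hΘ : Θ ⊆ Set.Ioi (0 : ℝ) ×ˢ Set.Ioi (0 : ℝ))
    (k₀ : ℕ) (hk₀ : 2 ≤ k₀)
    (G₀ : Mix (ℝ × ℝ) k₀) (hmem : ∀ i, G₀.atom i ∈ interior Θ)
    (ha : ∀ i, 1 ≤ (G₀.atom i).1)
    (hpath : ∃ i j, i ≠ j ∧ (G₀.atom i).2 = (G₀.atom j).2 ∧
      |(G₀.atom i).1 - (G₀.atom j).1| = 1) :
    ∀ r : ℝ, 1 ≤ r → ∀ δ > (0 : ℝ), ∀ ε > (0 : ℝ),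
      ∃ G : Mix (ℝ × ℝ) k₀, (∀ i, G.atom i ∈ Θ) ∧
        0 < Wr pairDist r G G₀ ∧ Wr pairDist r G G₀ ≤ ε ∧
        TVline (Set.Ioi 0) (Mix.density gammaFam G) (Mix.density gammaFam G₀)
          < δ * Wr pairDist r G G₀ ^ r := by
  intro r hr δ hδ ε hε
  obtain ⟨i, j, hij, hb, hshape⟩ : ∃ i j, i ≠ j ∧ (G₀.atom j).2 = (G₀.atom i).2 ∧
      (G₀.atom j).1 = (G₀.atom i).1 + 1 := by
    obtain ⟨i, j, hij, hb, h⟩ := hpath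
    rcases (abs_eq zero_le_one).1 h with h | h
    · exact ⟨j, i, hij.symm, hb, by linarith⟩
    · exact ⟨i, j, hij, hb.symm, by linarith⟩
  have hr0 : 0 < r := by linarith
  have ha1 := ha i
  have hb0 : 0 < (G₀.atom i).2 := (hΘ (interior_subset (hmem i))).2
  have hp := G₀.w_pos i
  have hp1 : G₀.w i ≤ 1 := by
    rw [← G₀.w_sum]
    exact Finset.single_le_sum (fun l _ => (G₀.w_pos l).le) (Finset.mem_univ i)
  have hatomj : G₀.atom j = ((G₀.atom i).1 + 1, (G₀.atom i).2) := Prod.ext hshape hb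
  have hatomi : G₀.atom i = ((G₀.atom i).1, (G₀.atom i).2) := rfl
  generalize (G₀.atom i).1 = a at *
  generalize (G₀.atom i).2 = b at *
  have ha0 : 0 < a := by linarith
  set p := G₀.w i
  set c := p * (a / b) with hc
  have hc0 : 0 < c := by positivity
  obtain ⟨d, hd, hdist⟩ : ∃ d : ℝ, 0 < d ∧
      ∀ l, l ≠ j → d ≤ pairDist (G₀.atom j) (G₀.atom l) ^ r := by
    have : Nonempty {l // l ≠ j} := ⟨⟨i, hij⟩⟩
    obtain ⟨l, hl⟩ := Finite.exists_min
      (fun l : {l // l ≠ j} => pairDist (G₀.atom j) (G₀.atom l) ^ r)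
    exact ⟨_, Real.rpow_pos_of_pos (pairDist_pos (G₀.atom_inj.ne l.2.symm)) r,
      fun l' hl' => hl ⟨l', hl'⟩⟩
  set g : ℝ → ℝ := fun x => p * ((a / b) ^ 2 + x ^ 2) * gammaDensity a b x
  have hgint : IntegrableOn g (Set.Ioi 0) :=
    integrableOn_quadratic_mul_gammaDensity ha0 hb0 p ((a / b) ^ 2)
  set M := ∫ x in Set.Ioi 0, g x
  have hpath_tendsto : Filter.Tendsto (fun t : ℝ => (a, b + t)) (nhdsWithin 0 (Set.Ioi 0))
      (nhds (G₀.atom i)) := by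
    have : Continuous fun t : ℝ => (a, b + t) := by fun_prop
    have h := this.tendsto 0
    rw [add_zero, ← hatomi] at h
    exact h.mono_left nhdsWithin_le_nhds
  have hsmall : ∀ A B : ℝ, 0 < B → ∀ᶠ t in nhdsWithin (0 : ℝ) (Set.Ioi 0), A * t < B := by
    intro A B hB
    have h : Filter.Tendsto (fun t : ℝ => A * t) (nhds 0) (nhds 0) :=
      (continuous_const_mul A).tendsto' 0 0 (mul_zero A)
    exact (h.mono_left nhdsWithin_le_nhds).eventually_lt_const hB
  have hΘev : ∀ᶠ t in nhdsWithin (0 : ℝ) (Set.Ioi 0), (a, b + t) ∈ Θ :=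
    hpath_tendsto.eventually (mem_interior_iff_mem_nhds.1 (hmem i))
  have hneev : ∀ᶠ t in nhdsWithin (0 : ℝ) (Set.Ioi 0), ∀ l, l ≠ i → (a, b + t) ≠ G₀.atom l := by
    refine Filter.eventually_all.2 fun l => ?_
    by_cases hl : l = i
    · simp [hl]
    · filter_upwards [hpath_tendsto.eventually_ne (G₀.atom_inj.ne (Ne.symm hl))] with t ht _
      exact ht
  obtain ⟨t, hΘt, hne, hat, ht1, htε, htM, (ht : 0 < t)⟩ := (hΘev.and <| hneev.and <|
    (hsmall (a / b) 1 one_pos).and <| (hsmall 1 1 one_pos).and <|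
    (hsmall (1 + c) (ε ^ r) (Real.rpow_pos_of_pos hε r)).and <|
    (hsmall M (2 * (δ * (c * d))) (by positivity)).and self_mem_nhdsWithin).exists
  have hct0 : 0 ≤ c * t := by positivity
  have hctp : c * t < p := by
    have : p * (a / b * t) < p * 1 := mul_lt_mul_of_pos_left hat hp
    rw [hc]; linarith
  set G := G₀.shift i j hij (a, b + t) (c * t) hct0 hctp hne with hG
  have hlow : c * t * d ≤ WrPow pairDist r G G₀ := by
    have hGj : G.atom j = G₀.atom j := by simp [hG, Mix.shift, hij.symm]
    have hGw : G.w j - G₀.w j = c * t := by simp [hG, Mix.shift, hij.symm]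
    rw [← hGw]
    exact excess_mass_mul_le_WrPow hd.le G G₀ j j (by rwa [hGj])
  have hup : WrPow pairDist r G G₀ ≤ (1 + c) * t := by
    refine (WrPow_shift_le G₀ i j hij _ _ hct0 hctp hne hr0).trans ?_
    have h1 : pairDist (a, b + t) (G₀.atom i) = t := by
      rw [hatomi]; simp [pairDist, Real.sqrt_sq ht.le]
    have h2 : pairDist (G₀.atom j) (G₀.atom i) = 1 := by
      rw [hatomj, hatomi]; simp [pairDist]
    have h3 : t ^ r ≤ t := by
      simpa using Real.rpow_le_rpow_of_exponent_ge ht (by linarith) hr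
    have h4 : 0 ≤ t ^ r := Real.rpow_nonneg ht.le r
    rw [h1, h2, Real.one_rpow]
    nlinarith
  have hpos : 0 < WrPow pairDist r G G₀ := lt_of_lt_of_le (by positivity) hlow
  have hWr : Wr pairDist r G G₀ ^ r = WrPow pairDist r G G₀ := by
    rw [Wr, ← Real.rpow_mul hpos.le, one_div_mul_cancel hr0.ne', Real.rpow_one]
  refine ⟨G, ?_, Real.rpow_pos_of_pos hpos _, ?_, ?_⟩
  · intro l
    by_cases hl : l = i
    · subst hl; simpa [hG, Mix.shift] using hΘt
    · simpa [hG, Mix.shift, hl] using interior_subset (hmem l)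
  · rw [← Real.rpow_le_rpow_iff (x := Wr pairDist r G G₀) (Real.rpow_nonneg hpos.le _) hε.le hr0]
    exact hWr.le.trans (hup.trans htε.le)
  · rw [hWr]
    have hint : ∫ x in Set.Ioi 0, |Mix.density gammaFam G x - Mix.density gammaFam G₀ x|
        ≤ ∫ x in Set.Ioi 0, t ^ 2 * g x := by
      refine integral_mono_of_nonneg (Filter.Eventually.of_forall fun x => abs_nonneg _)
        (hgint.const_mul _) ?_
      filter_upwards [ae_restrict_mem measurableSet_Ioi] with x hx
      rw [hG, density_shift_sub, hatomj, hatomi]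
      exact abs_gammaDensity_perturbation_le ha1 hb0 hp.le ht.le hat.le hx
    rw [integral_const_mul] at hint
    calc TVline (Set.Ioi 0) (Mix.density gammaFam G) (Mix.density gammaFam G₀)
        ≤ t / 2 * (M * t) := by unfold TVline; linarith
      _ < t / 2 * (2 * (δ * (c * d))) := mul_lt_mul_of_pos_left htM (by positivity)
      _ = δ * (c * t * d) := by ring
      _ ≤ _ := mul_le_mul_of_nonneg_left hlow hδ.le
end
end
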